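/- For all integers t ≥ 2 and k ≥ 2, the limit of C_{2(t−1)}(n, tk)/n^k as n → ∞ exists and equals (1/k!) · 1/C(tk−1, k−1), where C(a,b) denotes the binomial coefficient. -/

import Mathlib

open Finset

variable {α : Type*} {β : Type*}

/-- An `r`-graph `H` is `t`-cancellative if for any subfamily `𝒜 ⊆ H` of at most `t` edges and
any two further distinct edges `B, C ∈ H` not in `𝒜`, the symmetric difference of `B` and `C`
is not contained in the union of the edges of `𝒜`. -/
def IsCancellative [DecidableEq α] (t : ℕ) (H : Finset (Finset α)) : Prop :=
  ∀ 𝒜 ⊆ H, 𝒜.card ≤ t → ∀ B ∈ H, ∀ C ∈ H, B ∉ 𝒜 → C ∉ 𝒜 → B ≠ C →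
    ¬((B \ C) ∪ (C \ B) ⊆ 𝒜.sup id)

/-- An `r`-graph `H` is `t`-union-free if any two distinct nonempty subfamilies of `H`, each
consisting of at most `t` edges, have distinct unions. -/
def IsUnionFree [DecidableEq α] (t : ℕ) (H : Finset (Finset α)) : Prop :=
  ∀ 𝒜 ⊆ H, ∀ ℬ ⊆ H, 𝒜.Nonempty → ℬ.Nonempty → 𝒜.card ≤ t → ℬ.card ≤ t → 𝒜 ≠ ℬ →
    𝒜.sup id ≠ ℬ.sup id

/-- An `r`-graph `H` is `t`-cover-free if no edge of `H` is contained in the union of at most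
`t` other edges of `H`. -/
def IsCoverFree [DecidableEq α] (t : ℕ) (H : Finset (Finset α)) : Prop :=
  ∀ 𝒜 ⊆ H, 𝒜.card ≤ t → ∀ B ∈ H, B ∉ 𝒜 → ¬(B ⊆ 𝒜.sup id)

/-- `H` is `(v, e)`-free if any `e` distinct edges of `H` have union of size at least `v + 1`. -/
def IsVEFree [DecidableEq α] (v e : ℕ) (H : Finset (Finset α)) : Prop :=
  ∀ 𝒜 ⊆ H, 𝒜.card = e → v + 1 ≤ (𝒜.sup id).card

/-- The `k`-shadow of `F`: all `k`-subsets of the vertex set contained in some edge of `F`. -/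
def kShadow [DecidableEq α] (k : ℕ) (F : Finset (Finset α)) : Finset (Finset α) :=
  F.sup fun A => Finset.powersetCard k A

/-- `J'` is a copy of `J`: the image of `J` under a map injective on the vertex set of `J`. -/
def IsCopyOf [DecidableEq α] [DecidableEq β] (J' : Finset (Finset β))
    (J : Finset (Finset α)) : Prop :=
  ∃ f : α → β, Set.InjOn f ↑(J.sup id) ∧ J' = J.image fun A => A.image f

/-- The matching number of `H` is at most `b`: every subfamily of pairwise disjoint edges
has at most `b` members. -/
def MatchingNumberLE [DecidableEq α] (H : Finset (Finset α)) (b : ℕ) : Prop :=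
  ∀ M ⊆ H, (∀ A ∈ M, ∀ B ∈ M, A ≠ B → Disjoint A B) → M.card ≤ b

/-- `C_t(n, r)`: the maximum number of edges in an `n`-vertex `t`-cancellative `r`-graph. -/
noncomputable def maxCancellative (t n r : ℕ) : ℕ :=
  sSup {N | ∃ H : Finset (Finset (Fin n)),
    (∀ e ∈ H, e.card = r) ∧ IsCancellative t H ∧ H.card = N}

/-- `U_t(n, r)`: the maximum number of edges in an `n`-vertex `t`-union-free `r`-graph. -/
noncomputable def maxUnionFree (t n r : ℕ) : ℕ :=
  sSup {N | ∃ H : Finset (Finset (Fin n)),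
    (∀ e ∈ H, e.card = r) ∧ IsUnionFree t H ∧ H.card = N}

/-- `F_t(n, r)`: the maximum number of edges in an `n`-vertex `t`-cover-free `r`-graph. -/
noncomputable def maxCoverFree (t n r : ℕ) : ℕ :=
  sSup {N | ∃ H : Finset (Finset (Fin n)),
    (∀ e ∈ H, e.card = r) ∧ IsCoverFree t H ∧ H.card = N}

/-- Any two finite sets of equal size are related by a permutation of the ambient type. -/
theorem exists_perm_map_eq {X : Type*} [Fintype X] [DecidableEq X] {S T : Finset X}
    (h : S.card = T.card) : ∃ σ : Equiv.Perm X, S.map σ.toEmbedding = T := by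
  let e : {x // x ∈ S} ≃ {x // x ∈ T} := Finset.equivOfCardEq h
  refine ⟨e.extendSubtype, ?_⟩
  refine Finset.eq_of_subset_of_card_le ?_ (by simp [h])
  intro y hy
  obtain ⟨x, hx, rfl⟩ := Finset.mem_map.1 hy
  exact e.extendSubtype_mem x hx

/-- The `i`-th row of a `t × k` array listing the elements of `X`. -/
def block {X : Type*} [DecidableEq X] {t k : ℕ} (b : Fin t × Fin k ≃ X) (i : Fin t) : Finset X :=
  univ.image fun j => b (i, j)

theorem card_block {X : Type*} [DecidableEq X] {t k : ℕ} (b : Fin t × Fin k ≃ X) (i : Fin t) :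
    (block b i).card = k := by
  rw [block, card_image_of_injective _ fun x y h => by simpa using h]
  simp

theorem card_arrays_with_block {X : Type*} [Fintype X] [DecidableEq X] {t k : ℕ} (i : Fin t)
    {S T : Finset X} (h : S.card = T.card) :
    #{b : Fin t × Fin k ≃ X | block b i = S} = #{b : Fin t × Fin k ≃ X | block b i = T} := by
  obtain ⟨σ, rfl⟩ := exists_perm_map_eq h
  refine card_bij (fun b _ => b.trans σ) ?_ ?_ ?_
  · intro b hb
    simp only [mem_filter, mem_univ, true_and] at hb ⊢
    rw [← hb]
    ext x
    simp [block, Equiv.eq_symm_apply]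
  · intro b _ b' _ hbb
    ext x
    simpa using congrArg (fun f => f x) hbb
  · intro b hb
    refine ⟨b.trans σ.symm, ?_, by ext; simp⟩
    simp only [mem_filter, mem_univ, true_and] at hb ⊢
    apply Finset.map_injective σ.toEmbedding
    rw [← hb]
    ext x
    simp [block]

/-- A family of `k`-sets meeting every partition of a `tk`-set into `k`-sets contains at least
a `1/t` fraction of all `k`-sets. -/
theorem choose_le_mul_card_of_hits_blocks {X : Type*} [Fintype X] [DecidableEq X] {t k : ℕ}
    (hX : Fintype.card X = t * k) (O : Finset (Finset X)) (hO : ∀ T ∈ O, T.card = k)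
    (hit : ∀ b : Fin t × Fin k ≃ X, ∃ i, block b i ∈ O) :
    (t * k).choose k ≤ t * O.card := by
  classical
  let e : Fin t × Fin k ≃ X := Fintype.equivOfCardEq (by simp [hX])
  obtain ⟨i₀, h₀⟩ := hit e
  set K := fun i : Fin t => #{b : Fin t × Fin k ≃ X | block b i = block e i₀} with hK
  have hN : ∀ i T, T.card = k → #{b : Fin t × Fin k ≃ X | block b i = T} = K i := fun i T hT =>
    card_arrays_with_block i (by rw [hT, card_block])
  have htot : ∀ i, Fintype.card (Fin t × Fin k ≃ X) = (t * k).choose k * K i := by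
    intro i
    rw [← card_univ, card_eq_sum_card_fiberwise (f := fun b => block b i)
      (t := powersetCard k univ) (fun b _ => by simp [mem_powersetCard, card_block]),
      sum_congr rfl (fun T hT => hN i T (mem_powersetCard.1 hT).2)]
    simp [hX]
  have hpos : 0 < Fintype.card (Fin t × Fin k ≃ X) := Fintype.card_pos_iff.2 ⟨e⟩
  have hchoose : 0 < (t * k).choose k := by
    by_contra h
    have := htot i₀
    simp_all
  have hKc : ∀ i, K i = K i₀ := fun i =>
    Nat.eq_of_mul_eq_mul_left hchoose ((htot i).symm.trans (htot i₀))
  have hle : Fintype.card (Fin t × Fin k ≃ X) ≤ t * (O.card * K i₀) := by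
    calc Fintype.card (Fin t × Fin k ≃ X)
        ≤ (univ.biUnion fun i => {b : Fin t × Fin k ≃ X | block b i ∈ O} : Finset _).card := by
          rw [← card_univ]
          refine card_le_card fun b _ => ?_
          simpa using hit b
      _ ≤ ∑ i : Fin t, #{b : Fin t × Fin k ≃ X | block b i ∈ O} := card_biUnion_le
      _ = ∑ i : Fin t, O.card * K i₀ := by
          refine sum_congr rfl fun i _ => ?_
          rw [card_eq_sum_card_fiberwise (f := fun b => block b i) (t := O)
            (fun b hb => by simpa using hb), ← smul_eq_mul, ← sum_const]
          refine sum_congr rfl fun T hT => ?_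
          rw [← hKc i, ← hN i T (hO T hT), filter_filter]
          congr 1
          ext b
          simp only [mem_filter, mem_univ, true_and]
          exact ⟨fun h => h.2, fun h => ⟨h ▸ hT, h⟩⟩
      _ = t * (O.card * K i₀) := by simp
  have hKpos : 0 < K i₀ := by
    rw [Nat.pos_iff_ne_zero]
    intro h
    rw [htot i₀, h] at hpos
    simp at hpos
  rw [htot i₀, ← mul_assoc] at hle
  exact Nat.le_of_mul_le_mul_right hle hKpos

/-- A `k`-subset of `A` is attributed to `A` if `A` is the only edge of `H` containing it, or if it
belongs to a partition of `A` into `k`-sets each of which lies in another edge of `H`. -/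
def Attributed {V : Type*} [DecidableEq V] (H : Finset (Finset V)) (t k : ℕ) (A T : Finset V) :
    Prop :=
  (∀ B ∈ H, T ⊆ B → B = A) ∨
    ∃ b : Fin t × Fin k ≃ A, (∀ i, ∃ B ∈ H, (block b i).map (.subtype _) ⊆ B ∧ B ≠ A) ∧
      ∃ i, (block b i).map (.subtype _) = T

theorem exists_cover_sdiff {V : Type*} [DecidableEq V] {H : Finset (Finset V)} {t k : ℕ}
    {A C T : Finset V} (hTA : Attributed H t k A T) (hC : C ∈ H) (hAC : A ≠ C) (hT : T ⊆ C) :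
    ∃ 𝒜 ⊆ H, 𝒜.card ≤ t - 1 ∧ A ∉ 𝒜 ∧ A \ C ⊆ 𝒜.sup id := by
  rcases hTA with h | ⟨b, hb, i, rfl⟩
  · exact absurd (h C hC hT).symm hAC
  choose F hF hFs hFne using hb
  refine ⟨(univ.erase i).image F, ?_, ?_, ?_, ?_⟩
  · intro X hX
    obtain ⟨j, -, rfl⟩ := mem_image.1 hX
    exact hF j
  · exact card_image_le.trans (by simp)
  · intro hA
    obtain ⟨j, -, hj⟩ := mem_image.1 hA
    exact hFne j hj
  · intro x hx
    rw [mem_sdiff] at hx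
    obtain ⟨⟨j, l⟩, hjl⟩ := b.surjective ⟨x, hx.1⟩
    have hxj : x ∈ (block b j).map (.subtype _) := by
      simp only [block, mem_map, mem_image, mem_univ, true_and]
      exact ⟨⟨x, hx.1⟩, ⟨l, hjl⟩, rfl⟩
    have hji : j ≠ i := by
      rintro rfl
      exact hx.2 (hT hxj)
    rw [mem_sup]
    exact ⟨F j, mem_image_of_mem _ (by simp [hji]), hFs j hxj⟩

theorem Attributed.unique {V : Type*} [DecidableEq V] {H : Finset (Finset V)} {t k : ℕ}
    (hH : IsCancellative (2 * (t - 1)) H) {A B T : Finset V} (hA : A ∈ H) (hB : B ∈ H)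
    (hTA : T ⊆ A) (hTB : T ⊆ B) (h₁ : Attributed H t k A T) (h₂ : Attributed H t k B T) :
    A = B := by
  by_contra hAB
  obtain ⟨𝒜, h𝒜, hc, hA𝒜, hcov⟩ := exists_cover_sdiff h₁ hB hAB hTB
  obtain ⟨ℬ, hℬ, hc', hBℬ, hcov'⟩ := exists_cover_sdiff h₂ hA (Ne.symm hAB) hTA
  refine hH (𝒜.erase B ∪ ℬ.erase A) ?_ ?_ A hA B hB (by simp [hA𝒜]) (by simp [hBℬ]) hAB ?_
  · exact union_subset ((erase_subset _ _).trans h𝒜) ((erase_subset _ _).trans hℬ)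
  · refine (card_union_le _ _).trans ?_
    have := card_erase_le (s := 𝒜) (a := B)
    have := card_erase_le (s := ℬ) (a := A)
    omega
  · intro x hx
    rw [mem_sup]
    rcases mem_union.1 hx with hx | hx
    · obtain ⟨X, hX, hxX⟩ := mem_sup.1 (hcov hx)
      refine ⟨X, mem_union_left _ (mem_erase.2 ⟨?_, hX⟩), hxX⟩
      rintro rfl
      exact (mem_sdiff.1 hx).2 hxX
    · obtain ⟨X, hX, hxX⟩ := mem_sup.1 (hcov' hx)
      refine ⟨X, mem_union_right _ (mem_erase.2 ⟨?_, hX⟩), hxX⟩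
      rintro rfl
      exact (mem_sdiff.1 hx).2 hxX

open Classical in
theorem choose_le_card_attributed {V : Type*} [DecidableEq V] (H : Finset (Finset V)) {t k : ℕ}
    (ht : 0 < t) (hk : 0 < k) {A : Finset V} (hA : A.card = t * k) :
    (t * k - 1).choose (k - 1) ≤ #{T ∈ powersetCard k A | Attributed H t k A T} := by
  set O' : Finset (Finset A) :=
    {T ∈ powersetCard k univ | Attributed H t k A (T.map (.subtype _))} with hO'
  have hle : O'.card ≤ #{T ∈ powersetCard k A | Attributed H t k A T} := by
    refine card_le_card_of_injOn (fun T => T.map (.subtype _)) ?_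
      (fun _ _ _ _ h => Finset.map_injective _ h)
    intro T hT
    simp only [hO', coe_filter, Set.mem_ofPred_eq, mem_powersetCard, subset_univ, true_and] at hT
    simp only [coe_filter, Set.mem_ofPred_eq, mem_powersetCard, card_map]
    exact ⟨⟨Finset.map_subtype_subset _, hT.1⟩, hT.2⟩
  have hmain := choose_le_mul_card_of_hits_blocks (X := A) (t := t) (k := k) (by simpa using hA) O'
    (fun T hT => by
      simp only [hO', mem_filter, mem_powersetCard] at hT
      exact hT.1.2) (by
      intro b
      by_contra! hb
      have hb' : ∀ i, ¬ Attributed H t k A ((block b i).map (.subtype _)) := fun i h =>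
        hb i (by
          simp only [hO', mem_filter, mem_powersetCard]
          exact ⟨⟨subset_univ _, card_block b i⟩, h⟩)
      refine hb' ⟨0, ht⟩ (Or.inr ⟨b, fun i => ?_, _, rfl⟩)
      have := hb' i
      simp only [Attributed, not_or, not_forall] at this
      obtain ⟨⟨B, hB, hs, hne⟩, -⟩ := this
      exact ⟨B, hB, hs, hne⟩)
  have hchoose : (t * k).choose k = t * (t * k - 1).choose (k - 1) := by
    have h := Nat.add_one_mul_choose_eq (t * k - 1) (k - 1)
    rw [Nat.sub_add_cancel (Nat.mul_pos ht hk), Nat.sub_add_cancel hk] at h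
    refine Nat.eq_of_mul_eq_mul_right hk ?_
    rw [← h]; ring
  rw [hchoose] at hmain
  exact (Nat.le_of_mul_le_mul_left hmain ht).trans hle

theorem IsCancellative.card_mul_choose_le {n t k : ℕ} (ht : 0 < t) (hk : 0 < k)
    {H : Finset (Finset (Fin n))} (hcard : ∀ e ∈ H, e.card = t * k)
    (hH : IsCancellative (2 * (t - 1)) H) :
    H.card * (t * k - 1).choose (k - 1) ≤ n.choose k := by
  classical
  calc H.card * (t * k - 1).choose (k - 1)
      = ∑ A ∈ H, (t * k - 1).choose (k - 1) := by simp
    _ ≤ ∑ A ∈ H, #{T ∈ powersetCard k A | Attributed H t k A T} :=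
        sum_le_sum fun A hA => choose_le_card_attributed H ht hk (hcard A hA)
    _ = (H.biUnion fun A => {T ∈ powersetCard k A | Attributed H t k A T}).card := by
        refine (card_biUnion fun A hA B hB hAB => ?_).symm
        refine disjoint_left.2 fun T h₁ h₂ => hAB ?_
        simp only [mem_filter, mem_powersetCard] at h₁ h₂
        exact Attributed.unique hH hA hB h₁.1.1 h₂.1.1 h₁.2 h₂.2
    _ ≤ (powersetCard k (univ : Finset (Fin n))).card := by
        refine card_le_card fun T hT => ?_
        simp only [mem_biUnion, mem_filter, mem_powersetCard] at hT
        obtain ⟨A, -, hT, -⟩ := hT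
        simpa [mem_powersetCard] using hT.2
    _ = n.choose k := by simp

open Classical in
/-- The total weight of the outcomes satisfying `p`. -/
noncomputable def pr {Ω : Type*} [Fintype Ω] (μ : Ω → ℝ) (p : Ω → Prop) : ℝ :=
  ∑ ω, if p ω then μ ω else 0

theorem pr_nonneg {Ω : Type*} [Fintype Ω] {μ : Ω → ℝ} (hμ : ∀ ω, 0 ≤ μ ω) (p : Ω → Prop) :
    0 ≤ pr μ p := by
  classical
  exact sum_nonneg fun ω _ => by split_ifs <;> simp [hμ]

theorem pr_mono {Ω : Type*} [Fintype Ω] {μ : Ω → ℝ} (hμ : ∀ ω, 0 ≤ μ ω) {p q : Ω → Prop}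
    (h : ∀ ω, p ω → q ω) : pr μ p ≤ pr μ q := by
  classical
  refine sum_le_sum fun ω _ => ?_
  by_cases hp : p ω
  · simp [hp, h ω hp]
  · by_cases hq : q ω <;> simp [hp, hq, hμ]

theorem pr_true {Ω : Type*} [Fintype Ω] (μ : Ω → ℝ) : pr μ (fun _ => True) = ∑ ω, μ ω := by
  simp [pr]

theorem pr_le_one {Ω : Type*} [Fintype Ω] {μ : Ω → ℝ} (hμ : ∀ ω, 0 ≤ μ ω) (h1 : ∑ ω, μ ω = 1)
    (p : Ω → Prop) : pr μ p ≤ 1 := by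
  rw [← h1, ← pr_true]
  exact pr_mono hμ fun _ _ => trivial

theorem pr_le_sum {Ω ι : Type*} [Fintype Ω] {μ : Ω → ℝ} (hμ : ∀ ω, 0 ≤ μ ω) {p : Ω → Prop}
    {s : Finset ι} {q : ι → Ω → Prop} (h : ∀ ω, p ω → ∃ i ∈ s, q i ω) :
    pr μ p ≤ ∑ i ∈ s, pr μ (q i) := by
  classical
  simp only [pr]
  rw [sum_comm]
  refine sum_le_sum fun ω _ => ?_
  have hnn : ∀ i ∈ s, 0 ≤ if q i ω then μ ω else 0 :=
    fun i _ => by split_ifs <;> simp [hμ]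
  by_cases hp : p ω
  · obtain ⟨i, hi, hq⟩ := h ω hp
    have := single_le_sum (f := fun i => if q i ω then μ ω else 0) hnn hi
    simpa [hp, hq] using this
  · simpa [hp] using sum_nonneg hnn

theorem pr_prod {Ω Ω' : Type*} [Fintype Ω] [Fintype Ω'] (μ : Ω → ℝ) (ν : Ω' → ℝ) (p : Ω → Prop)
    (q : Ω' → Prop) :
    pr (fun x : Ω × Ω' => μ x.1 * ν x.2) (fun x => p x.1 ∧ q x.2) = pr μ p * pr ν q := by
  classical
  rw [pr, pr, pr, sum_mul_sum, Fintype.sum_prod_type]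
  refine sum_congr rfl fun ω _ => sum_congr rfl fun ω' _ => ?_
  by_cases hp : p ω <;> by_cases hq : q ω' <;> simp [hp, hq]

theorem sum_mul_card_eq_sum_pr {Ω ι : Type*} [Fintype Ω] [Fintype ι] (μ : Ω → ℝ)
    (X : Ω → Finset ι) : ∑ ω, μ ω * (X ω).card = ∑ i, pr μ (fun ω => i ∈ X ω) := by
  classical
  simp only [pr]
  rw [sum_comm]
  refine sum_congr rfl fun ω _ => ?_
  rw [sum_congr rfl (g := fun i => μ ω * (if i ∈ X ω then 1 else 0)) (fun i _ => by simp),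
    ← mul_sum]
  simp

/-- The weight of `S` as a random set containing each element independently with probability
`p`. -/
def bernoulliWeight {P : Type*} [Fintype P] [DecidableEq P] (p : ℝ) (S : Finset P) : ℝ :=
  ∏ φ, if φ ∈ S then p else 1 - p

theorem bernoulliWeight_nonneg {P : Type*} [Fintype P] [DecidableEq P] {p : ℝ} (h0 : 0 ≤ p)
    (h1 : p ≤ 1) (S : Finset P) : 0 ≤ bernoulliWeight p S :=
  prod_nonneg fun φ _ => by split_ifs <;> linarith

theorem pr_bernoulliWeight {P : Type*} [Fintype P] [DecidableEq P] (p : ℝ) {D N : Finset P}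
    (hDN : Disjoint D N) :
    pr (bernoulliWeight p) (fun S => D ⊆ S ∧ Disjoint N S) = p ^ D.card * (1 - p) ^ N.card := by
  classical
  set f : P → ℝ := fun φ => if φ ∈ N then 0 else p with hf
  set g : P → ℝ := fun φ => if φ ∈ D then 0 else 1 - p with hg
  have key : ∏ φ, (f φ + g φ) = p ^ D.card * (1 - p) ^ N.card := by
    have : ∀ φ, f φ + g φ = (if φ ∈ D then p else 1) * (if φ ∈ N then 1 - p else 1) := by
      intro φ
      by_cases h1 : φ ∈ D
      · simp [hf, hg, h1, disjoint_left.1 hDN h1]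
      · by_cases h2 : φ ∈ N <;> simp [hf, hg, h1, h2]
    rw [prod_congr rfl fun φ _ => this φ, prod_mul_distrib, prod_ite_mem, prod_ite_mem]
    simp
  rw [← key, prod_add, powerset_univ, pr]
  refine sum_congr rfl fun S _ => ?_
  split_ifs with h
  · have h1 : ∏ φ ∈ S, f φ = ∏ φ ∈ S, p := prod_congr rfl fun φ hφ => by
      simp [hf, disjoint_right.1 h.2 hφ]
    have h2 : ∏ φ ∈ univ \ S, g φ = ∏ φ ∈ univ \ S, (1 - p) := prod_congr rfl fun φ hφ => by
      have : φ ∉ D := fun h' => (mem_sdiff.1 hφ).2 (h.1 h')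
      simp [hg, this]
    rw [h1, h2, bernoulliWeight, prod_ite]
    congr 1
    · simp
    · congr 1; ext; simp
  · symm
    rw [not_and_or] at h
    rcases h with h | h
    · obtain ⟨φ, hφ, hφS⟩ := not_subset.1 h
      rw [prod_eq_zero (i := φ) (s := univ \ S) (by simpa using hφS) (by simp [hg, hφ]), mul_zero]
    · obtain ⟨φ, hφ, hφS⟩ := not_disjoint_iff.1 h
      rw [prod_eq_zero (i := φ) (s := S) hφS (by simp [hf, hφ]), zero_mul]

theorem pr_bernoulliWeight_subset {P : Type*} [Fintype P] [DecidableEq P] (p : ℝ) (D : Finset P) :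
    pr (bernoulliWeight p) (fun S => D ⊆ S) = p ^ D.card := by
  simpa using pr_bernoulliWeight p (disjoint_empty_right D)

theorem sum_bernoulliWeight {P : Type*} [Fintype P] [DecidableEq P] (p : ℝ) :
    ∑ S : Finset P, bernoulliWeight p S = 1 := by
  simpa [pr_true] using pr_bernoulliWeight_subset p (∅ : Finset P)

/-- A system of edges `φ`, each claiming `s` vertices and dumping `j` further vertices, such that
every vertex is claimed by exactly `A` edges and any two vertices lie in at most `ε A` common
edges. -/
structure IsClaimSystem {𝒱 P : Type*} [Fintype P] [DecidableEq 𝒱] (cl jk : P → Finset 𝒱)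
    (s j A : ℕ) (ε : ℝ) : Prop where
  card_cl : ∀ φ, (cl φ).card = s
  card_jk : ∀ φ, (jk φ).card = j
  disjoint : ∀ φ, Disjoint (cl φ) (jk φ)
  degree : ∀ T, #{φ | T ∈ cl φ} = A
  codegree : ∀ T T', T ≠ T' → (#{φ | T ∈ cl φ ∪ jk φ ∧ T' ∈ cl φ ∪ jk φ} : ℝ) ≤ ε * A
  one_le : 1 ≤ ε * A

/-- A random family of edges with disjoint claims whose dumped vertices lie in a random set
`junk`; the vertices that are neither claimed nor in `junk` are `free`. -/
structure RandomPacking {𝒱 P : Type} [DecidableEq 𝒱] (cl jk : P → Finset 𝒱) where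
  Ω : Type
  fintype : Fintype Ω
  μ : Ω → ℝ
  nonneg : ∀ ω, 0 ≤ μ ω
  sum_eq_one : ∑ ω, μ ω = 1
  free : Ω → Finset 𝒱
  junk : Ω → Finset 𝒱
  chosen : Ω → Finset P
  disjoint_free_junk : ∀ ω, Disjoint (free ω) (junk ω)
  disjoint_free : ∀ ω, ∀ φ ∈ chosen ω, Disjoint (cl φ) (free ω)
  disjoint_junk : ∀ ω, ∀ φ ∈ chosen ω, Disjoint (cl φ) (junk ω)
  subset_junk : ∀ ω, ∀ φ ∈ chosen ω, jk φ ⊆ junk ω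
  pairwise : ∀ ω, ∀ φ ∈ chosen ω, ∀ ψ ∈ chosen ω, φ ≠ ψ → Disjoint (cl φ) (cl ψ)
  cover : ∀ ω T, T ∈ free ω ∨ T ∈ junk ω ∨ ∃ φ ∈ chosen ω, T ∈ cl φ

attribute [instance] RandomPacking.fintype

/-- The events `T ∈ free` and `T ∈ junk` behave, in bounded collections of vertices, like
independent events of probability `u` and `z`. -/
def RandomPacking.NearlyIndependent {𝒱 P : Type} [DecidableEq 𝒱] {cl jk : P → Finset 𝒱}
    (R : RandomPacking cl jk) (u z : ℝ) (E : ℕ) (η : ℝ) : Prop :=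
  ∀ 𝒯 𝒯' : Finset 𝒱, Disjoint 𝒯 𝒯' → 𝒯.card + 𝒯'.card ≤ E →
    |pr R.μ (fun ω => 𝒯 ⊆ R.free ω ∧ 𝒯' ⊆ R.junk ω) - u ^ 𝒯.card * z ^ 𝒯'.card| ≤ η

/-- Any given edges are chosen simultaneously with probability at most `a` to their number. -/
def RandomPacking.MomentBound {𝒱 P : Type} [DecidableEq 𝒱] {cl jk : P → Finset 𝒱}
    (R : RandomPacking cl jk) (a : ℝ) : Prop :=
  ∀ D : Finset P, pr R.μ (fun ω => D ⊆ R.chosen ω) ≤ a ^ D.card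

/-- A sampled edge is accepted if no other sampled edge meets its claim, its claim is free and
what it dumps is junk. -/
def Accepted {𝒱 P : Type} (cl jk : P → Finset 𝒱) (U Z : Finset 𝒱) (S : Finset P) (φ : P) : Prop :=
  φ ∈ S ∧ (∀ ψ ∈ S, ψ ≠ φ → Disjoint (cl ψ) (cl φ)) ∧ cl φ ⊆ U ∧ jk φ ⊆ Z

open Classical in
/-- The set of accepted edges. -/
noncomputable def accepted {𝒱 P : Type} [Fintype P] (cl jk : P → Finset 𝒱) (U Z : Finset 𝒱)
    (S : Finset P) : Finset P :=
  {φ | Accepted cl jk U Z S φ}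

theorem mem_accepted {𝒱 P : Type} [Fintype P] {cl jk : P → Finset 𝒱} {U Z : Finset 𝒱}
    {S : Finset P} {φ : P} :
    φ ∈ accepted cl jk U Z S ↔ Accepted cl jk U Z S φ := by
  simp [accepted]

section Nibble

variable {𝒱 P : Type} [Fintype P] [DecidableEq 𝒱] [DecidableEq P] {cl jk : P → Finset 𝒱}

/-- One round: sample edges independently with probability `p` and add the accepted ones. -/
noncomputable def RandomPacking.nibble (R : RandomPacking cl jk) (p : ℝ) (h0 : 0 ≤ p)
    (h1 : p ≤ 1) : RandomPacking cl jk where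
  Ω := R.Ω × Finset P
  fintype := inferInstance
  μ x := R.μ x.1 * bernoulliWeight p x.2
  nonneg x := mul_nonneg (R.nonneg _) (bernoulliWeight_nonneg h0 h1 _)
  sum_eq_one := by
    rw [Fintype.sum_prod_type, ← sum_mul_sum, R.sum_eq_one, sum_bernoulliWeight, one_mul]
  free x := R.free x.1 \ (accepted cl jk (R.free x.1) (R.junk x.1) x.2).biUnion cl
  junk x := R.junk x.1
  chosen x := R.chosen x.1 ∪ accepted cl jk (R.free x.1) (R.junk x.1) x.2
  disjoint_free_junk x := (R.disjoint_free_junk x.1).mono_left sdiff_subset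
  disjoint_free x φ hφ := by
    rcases mem_union.1 hφ with h | h
    · exact (R.disjoint_free x.1 φ h).mono_right sdiff_subset
    · exact disjoint_left.2 fun T hT hT' =>
        (mem_sdiff.1 hT').2 (mem_biUnion.2 ⟨φ, h, hT⟩)
  disjoint_junk x φ hφ := by
    rcases mem_union.1 hφ with h | h
    · exact R.disjoint_junk x.1 φ h
    · exact (R.disjoint_free_junk x.1).mono_left (mem_accepted.1 h).2.2.1
  subset_junk x φ hφ := by
    rcases mem_union.1 hφ with h | h
    · exact R.subset_junk x.1 φ h
    · exact (mem_accepted.1 h).2.2.2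
  pairwise x φ hφ ψ hψ hne := by
    rcases mem_union.1 hφ with h | h <;> rcases mem_union.1 hψ with h' | h'
    · exact R.pairwise x.1 φ h ψ h' hne
    · exact (R.disjoint_free x.1 φ h).mono_right (mem_accepted.1 h').2.2.1
    · exact ((R.disjoint_free x.1 ψ h').mono_right (mem_accepted.1 h).2.2.1).symm
    · exact (mem_accepted.1 h').2.1 φ (mem_accepted.1 h).1 hne
  cover x T := by
    rcases R.cover x.1 T with h | h | ⟨φ, hφ, hT⟩
    · by_cases hT : T ∈ (accepted cl jk (R.free x.1) (R.junk x.1) x.2).biUnion cl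
      · obtain ⟨φ, hφ, hT⟩ := mem_biUnion.1 hT
        exact Or.inr (Or.inr ⟨φ, mem_union_right _ hφ, hT⟩)
      · exact Or.inl (mem_sdiff.2 ⟨h, hT⟩)
    · exact Or.inr (Or.inl h)
    · exact Or.inr (Or.inr ⟨φ, mem_union_left _ hφ, hT⟩)

theorem RandomPacking.MomentBound.nibble {R : RandomPacking cl jk} {a p : ℝ}
    (hR : R.MomentBound a) (h0 : 0 ≤ p) (h1 : p ≤ 1) :
    (R.nibble p h0 h1).MomentBound (a + p) := by
  classical
  intro D
  have hpt : ∀ x : R.Ω × Finset P, D ⊆ (R.nibble p h0 h1).chosen x →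
      ∃ D₁ ∈ D.powerset, D₁ ⊆ R.chosen x.1 ∧ D \ D₁ ⊆ x.2 := by
    intro x hx
    refine ⟨D ∩ R.chosen x.1, by simp, inter_subset_right, fun φ hφ => ?_⟩
    simp only [mem_sdiff, mem_inter, not_and] at hφ
    rcases mem_union.1 (hx hφ.1) with h | h
    · exact absurd h (hφ.2 hφ.1)
    · exact (mem_accepted.1 h).1
  calc pr (R.nibble p h0 h1).μ (fun x => D ⊆ (R.nibble p h0 h1).chosen x)
      ≤ ∑ D₁ ∈ D.powerset, pr (R.nibble p h0 h1).μ
          (fun x => D₁ ⊆ R.chosen x.1 ∧ D \ D₁ ⊆ x.2) :=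
        pr_le_sum (R.nibble p h0 h1).nonneg hpt
    _ ≤ ∑ D₁ ∈ D.powerset, a ^ D₁.card * p ^ (D.card - D₁.card) := by
        refine sum_le_sum fun D₁ hD₁ => ?_
        have := pr_prod R.μ (bernoulliWeight p) (fun ω => D₁ ⊆ R.chosen ω) (fun S => D \ D₁ ⊆ S)
        refine (le_of_eq this).trans ?_
        rw [pr_bernoulliWeight_subset, card_sdiff_of_subset (mem_powerset.1 hD₁)]
        exact mul_le_mul_of_nonneg_right (hR D₁) (pow_nonneg h0 _)
    _ = (a + p) ^ D.card := sum_pow_mul_eq_add_pow _ _ _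

/-- The probability that all edges in `D` are accepted, `𝒯` remains free, `𝒜` was free before
the round and `𝒯'` is junk. -/
noncomputable def RandomPacking.roundProb (R : RandomPacking cl jk) (p : ℝ)
    (𝒜 : Finset 𝒱) (D : Finset P) (𝒯 𝒯' : Finset 𝒱) : ℝ :=
  pr (fun x : R.Ω × Finset P => R.μ x.1 * bernoulliWeight p x.2) fun x =>
    𝒜 ⊆ R.free x.1 ∧ (∀ φ ∈ D, Accepted cl jk (R.free x.1) (R.junk x.1) x.2 φ) ∧
      𝒯 ⊆ R.free x.1 \ (accepted cl jk (R.free x.1) (R.junk x.1) x.2).biUnion cl ∧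
      𝒯' ⊆ R.junk x.1

theorem RandomPacking.roundProb_le (R : RandomPacking cl jk) {p : ℝ} (h0 : 0 ≤ p) (h1 : p ≤ 1)
    (𝒜 : Finset 𝒱) (D : Finset P) (𝒯 𝒯' : Finset 𝒱) : R.roundProb p 𝒜 D 𝒯 𝒯' ≤ p ^ D.card := by
  refine (pr_mono (R.nibble p h0 h1).nonneg (q := fun x => True ∧ D ⊆ x.2) ?_).trans ?_
  · rintro x ⟨-, h, -⟩
    exact ⟨trivial, fun φ hφ => (h φ hφ).1⟩
  · refine (le_of_eq (pr_prod R.μ (bernoulliWeight p) (fun _ => True) (fun S => D ⊆ S))).trans ?_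
    rw [pr_true, R.sum_eq_one, one_mul, pr_bernoulliWeight_subset]

theorem RandomPacking.roundProb_nonneg (R : RandomPacking cl jk) {p : ℝ} (h0 : 0 ≤ p) (h1 : p ≤ 1)
    (𝒜 : Finset 𝒱) (D : Finset P) (𝒯 𝒯' : Finset 𝒱) : 0 ≤ R.roundProb p 𝒜 D 𝒯 𝒯' :=
  pr_nonneg (R.nibble p h0 h1).nonneg _

theorem RandomPacking.roundProb_insert (R : RandomPacking cl jk) (p : ℝ)
    (𝒜 : Finset 𝒱) (D : Finset P) {T : 𝒱} {𝒯 : Finset 𝒱} (𝒯' : Finset 𝒱) :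
    R.roundProb p 𝒜 D (insert T 𝒯) 𝒯' = R.roundProb p (insert T 𝒜) D 𝒯 𝒯' -
      ∑ φ with T ∈ cl φ, R.roundProb p 𝒜 (insert φ D) 𝒯 𝒯' := by
  classical
  simp only [roundProb, pr]
  rw [sum_comm, ← sum_sub_distrib]
  refine sum_congr rfl fun x _ => ?_
  set U := R.free x.1
  set Z := R.junk x.1
  set m := R.μ x.1 * bernoulliWeight p x.2
  set C := (accepted cl jk U Z x.2).biUnion cl with hC
  simp only [insert_subset_iff, mem_insert, forall_eq_or_imp]
  by_cases hTC : T ∈ C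
  · obtain ⟨φ, hφ, hTφ⟩ := mem_biUnion.1 hTC
    have hacc := mem_accepted.1 hφ
    have hTU : T ∈ U := hacc.2.2.1 hTφ
    rw [sum_eq_single_of_mem φ (by simp [hTφ])]
    · simp [hTC, hTU, hacc]
    · intro ψ hψ hne
      rw [if_neg]
      rintro ⟨-, ⟨hψacc, -⟩, -⟩
      exact disjoint_left.1 (hacc.2.1 ψ hψacc.1 hne) (mem_filter.1 hψ).2 hTφ
  · rw [sum_eq_zero]
    · simp only [mem_sdiff, hTC, not_false_eq_true, and_true, sub_zero]
      congr 1
      exact propext (by tauto)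
    · intro φ hφ
      rw [if_neg]
      rintro ⟨-, ⟨hacc, -⟩, -⟩
      exact hTC (mem_biUnion.2 ⟨φ, mem_accepted.2 hacc, (mem_filter.1 hφ).2⟩)

end Nibble

section NearIndependence

variable {𝒱 P : Type} [Fintype P] [DecidableEq 𝒱] {cl jk : P → Finset 𝒱}
  {s j A : ℕ} {ε : ℝ}

/-- The edges in `D` have disjoint supports, and these and the three sets are all disjoint. -/
structure Generic (cl jk : P → Finset 𝒱) (𝒜 : Finset 𝒱) (D : Finset P) (𝒯 𝒯' : Finset 𝒱) :
    Prop where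
  pairwise : ∀ φ ∈ D, ∀ ψ ∈ D, φ ≠ ψ → Disjoint (cl φ ∪ jk φ) (cl ψ ∪ jk ψ)
  disjoint : ∀ φ ∈ D, Disjoint (cl φ ∪ jk φ) (𝒜 ∪ 𝒯 ∪ 𝒯')
  disjoint₁ : Disjoint 𝒜 𝒯
  disjoint₂ : Disjoint 𝒜 𝒯'
  disjoint₃ : Disjoint 𝒯 𝒯'

theorem Generic.card_claims (h : IsClaimSystem cl jk s j A ε) {𝒜 𝒯 𝒯' : Finset 𝒱} {D : Finset P}
    (hg : Generic cl jk 𝒜 D 𝒯 𝒯') : (D.biUnion cl).card = s * D.card := by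
  rw [card_biUnion fun φ hφ ψ hψ hne =>
    (hg.pairwise φ hφ ψ hψ hne).mono subset_union_left subset_union_left,
    sum_congr rfl fun φ _ => h.card_cl φ, sum_const, smul_eq_mul, mul_comm]

theorem Generic.card_junk (h : IsClaimSystem cl jk s j A ε) {𝒜 𝒯 𝒯' : Finset 𝒱} {D : Finset P}
    (hg : Generic cl jk 𝒜 D 𝒯 𝒯') : (D.biUnion jk).card = j * D.card := by
  rw [card_biUnion fun φ hφ ψ hψ hne =>
    (hg.pairwise φ hφ ψ hψ hne).mono subset_union_right subset_union_right,
    sum_congr rfl fun φ _ => h.card_jk φ, sum_const, smul_eq_mul, mul_comm]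

theorem IsClaimSystem.le_card_meeting (h : IsClaimSystem cl jk s j A ε) (R : Finset 𝒱) :
    (R.card * A : ℝ) ≤ #{φ | ¬Disjoint (cl φ) R} + R.card ^ 2 * (ε * A) := by
  have h0 : 0 ≤ ε * A := zero_le_one.trans h.one_le
  have h1 : R.card * A = ∑ φ : P, (R ∩ cl φ).card := by
    rw [← smul_eq_mul, ← sum_const, sum_congr rfl fun T _ => (h.degree T).symm]
    simp only [card_filter, ← filter_mem_eq_inter]
    exact sum_comm
  have h2 : ∀ φ : P, (R ∩ cl φ).card ≤
      (if ¬Disjoint (cl φ) R then 1 else 0) + (R ∩ cl φ).offDiag.card := by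
    intro φ
    simp only [offDiag_card, disjoint_iff_inter_eq_empty, inter_comm (cl φ), ← card_eq_zero]
    generalize #(R ∩ cl φ) = m
    rcases m with _ | _ | m
    · simp
    · simp
    · rw [if_pos (by omega)]
      have : (m + 1 + 1) * (m + 1 + 1) = (m + 1) * (m + 1 + 1) + (m + 1 + 1) := by ring
      rw [this]
      simp only [Nat.add_sub_cancel]
      nlinarith
  have h3 : ∑ φ : P, (R ∩ cl φ).offDiag.card ≤
      ∑ x ∈ R.offDiag, #{φ | x.1 ∈ cl φ ∪ jk φ ∧ x.2 ∈ cl φ ∪ jk φ} := by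
    simp only [card_filter]
    rw [sum_comm]
    refine sum_le_sum fun φ _ => ?_
    rw [← card_filter]
    refine card_le_card fun x hx => ?_
    simp only [mem_offDiag, mem_inter, mem_filter, mem_union] at hx ⊢
    tauto
  have h4 : (∑ x ∈ R.offDiag, #{φ | x.1 ∈ cl φ ∪ jk φ ∧ x.2 ∈ cl φ ∪ jk φ} : ℝ) ≤
      R.card ^ 2 * (ε * A) := by
    refine (sum_le_sum fun x hx => h.codegree x.1 x.2 (mem_offDiag.1 hx).2.2).trans ?_
    rw [sum_const, nsmul_eq_mul]
    refine mul_le_mul_of_nonneg_right ?_ h0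
    rw [offDiag_card, sq]
    exact_mod_cast Nat.sub_le _ _
  have h5 : R.card * A ≤ #{φ | ¬Disjoint (cl φ) R} +
      ∑ x ∈ R.offDiag, #{φ | x.1 ∈ cl φ ∪ jk φ ∧ x.2 ∈ cl φ ∪ jk φ} := by
    rw [h1, card_filter]
    refine (sum_le_sum fun φ _ => h2 φ).trans ?_
    rw [sum_add_distrib]
    exact Nat.add_le_add_left h3 _
  have h6 : (R.card * A : ℝ) ≤ #{φ | ¬Disjoint (cl φ) R} +
      ∑ x ∈ R.offDiag, (#{φ | x.1 ∈ cl φ ∪ jk φ ∧ x.2 ∈ cl φ ∪ jk φ} : ℝ) := by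
    exact_mod_cast h5
  linarith

variable [DecidableEq P]

theorem IsClaimSystem.card_codegree_le (h : IsClaimSystem cl jk s j A ε) (T : 𝒱)
    {W : Finset 𝒱} (hT : T ∉ W) :
    (#{φ | T ∈ cl φ ∧ ¬Disjoint (cl φ ∪ jk φ) W} : ℝ) ≤ W.card * (ε * A) := by
  have hsub : ({φ | T ∈ cl φ ∧ ¬Disjoint (cl φ ∪ jk φ) W} : Finset P) ⊆
      W.biUnion fun T' => {φ | T ∈ cl φ ∪ jk φ ∧ T' ∈ cl φ ∪ jk φ} := by
    intro φ hφ
    obtain ⟨-, h1, h2⟩ := mem_filter.1 hφ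
    obtain ⟨T', h3, h4⟩ := not_disjoint_iff.1 h2
    exact mem_biUnion.2 ⟨T', h4, mem_filter.2 ⟨mem_univ _, mem_union_left _ h1, h3⟩⟩
  calc (#{φ | T ∈ cl φ ∧ ¬Disjoint (cl φ ∪ jk φ) W} : ℝ)
      ≤ ∑ T' ∈ W, (#{φ | T ∈ cl φ ∪ jk φ ∧ T' ∈ cl φ ∪ jk φ} : ℝ) := by
        exact_mod_cast (card_le_card hsub).trans card_biUnion_le
    _ ≤ ∑ T' ∈ W, ε * A :=
        sum_le_sum fun T' hT' => h.codegree T T' fun e => hT (e ▸ hT')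
    _ = W.card * (ε * A) := by simp

theorem IsClaimSystem.card_meeting_le (h : IsClaimSystem cl jk s j A ε) (R : Finset 𝒱) :
    #{φ | ¬Disjoint (cl φ) R} ≤ R.card * A := by
  have hsub : ({φ | ¬Disjoint (cl φ) R} : Finset P) ⊆ R.biUnion fun T => {φ | T ∈ cl φ} := by
    intro φ hφ
    obtain ⟨T, h3, h4⟩ := not_disjoint_iff.1 (mem_filter.1 hφ).2
    exact mem_biUnion.2 ⟨T, h4, mem_filter.2 ⟨mem_univ _, h3⟩⟩
  refine (card_le_card hsub).trans (card_biUnion_le_card_mul _ _ _ fun T _ => (h.degree T).le)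

theorem one_sub_pow_sub_pow_le {p : ℝ} (h0 : 0 ≤ p) (h1 : p ≤ 1) {m n : ℕ} (h : m ≤ n) :
    |(1 - p) ^ m - (1 - p) ^ n| ≤ (n - m : ℝ) * p := by
  obtain ⟨l, rfl⟩ := Nat.exists_eq_add_of_le h
  have hb := one_add_mul_le_pow (a := -p) (by linarith) l
  have hm0 : 0 ≤ (1 - p) ^ m := pow_nonneg (by linarith) _
  have hm1 : (1 - p) ^ m ≤ 1 := pow_le_one₀ (by linarith) (by linarith)
  have hl1 : (1 - p) ^ l ≤ 1 := pow_le_one₀ (by linarith) (by linarith)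
  rw [← sub_eq_add_neg] at hb
  rw [pow_add, ← mul_one_sub, abs_of_nonneg (mul_nonneg hm0 (by linarith))]
  push_cast
  nlinarith

theorem RandomPacking.roundProb_empty (R : RandomPacking cl jk) (p : ℝ) {𝒜 𝒯' : Finset 𝒱}
    {D : Finset P} (hD : ∀ φ ∈ D, ∀ ψ ∈ D, φ ≠ ψ → Disjoint (cl φ) (cl ψ)) :
    R.roundProb p 𝒜 D ∅ 𝒯' =
      pr R.μ (fun ω => 𝒜 ∪ D.biUnion cl ⊆ R.free ω ∧ 𝒯' ∪ D.biUnion jk ⊆ R.junk ω) *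
        (p ^ D.card * (1 - p) ^ #{φ | φ ∉ D ∧ ¬Disjoint (cl φ) (D.biUnion cl)}) := by
  rw [← pr_bernoulliWeight p (disjoint_left.2 fun φ hφ hφ' => (mem_filter.1 hφ').2.1 hφ),
    ← pr_prod, roundProb]
  congr 1
  funext x
  simp only [union_subset_iff, biUnion_subset, empty_subset, true_and, eq_iff_iff, Accepted]
  constructor
  · rintro ⟨h1, h2, h3⟩
    refine ⟨⟨⟨h1, fun φ hφ => (h2 φ hφ).2.2.1⟩, h3, fun φ hφ => (h2 φ hφ).2.2.2⟩,
      fun φ hφ => (h2 φ hφ).1, disjoint_left.2 fun ψ hψ hψS => ?_⟩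
    obtain ⟨-, hψD, hψ⟩ := mem_filter.1 hψ
    exact hψ ((disjoint_biUnion_right _ _ _).2 fun φ hφ =>
      (h2 φ hφ).2.1 ψ hψS fun e => hψD (e ▸ hφ))
  · rintro ⟨⟨⟨h1, h2⟩, h3, h4⟩, h5, h6⟩
    refine ⟨h1, fun φ hφ => ⟨h5 hφ, fun ψ hψ hne => ?_, h2 φ hφ, h4 φ hφ⟩, h3⟩
    by_cases hψD : ψ ∈ D
    · exact hD ψ hψD φ hφ hne
    · by_contra hcon
      exact disjoint_left.1 h6 (mem_filter.2 ⟨mem_univ _, hψD,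
        fun h => hcon ((disjoint_biUnion_right _ _ _).1 h φ hφ)⟩) hψ

end NearIndependence

section NibbleIndependence

variable {𝒱 P : Type} [Fintype P] [DecidableEq 𝒱] [DecidableEq P] {cl jk : P → Finset 𝒱}
  {s j A : ℕ} {ε : ℝ}

theorem abs_mul_sub_mul_le {x y a b : ℝ} (hb0 : 0 ≤ b) (hb1 : b ≤ 1) (hx0 : 0 ≤ x)
    (hx1 : x ≤ 1) : |x * y - a * b| ≤ |x - a| + |y - b| := by
  have : x * y - a * b = (x - a) * b + x * (y - b) := by ring
  rw [this]
  refine (abs_add_le _ _).trans ?_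
  rw [abs_mul, abs_mul, abs_of_nonneg hb0, abs_of_nonneg hx0]
  have := abs_nonneg (x - a)
  have := abs_nonneg (y - b)
  nlinarith

theorem RandomPacking.abs_roundProb_empty_sub_le (h : IsClaimSystem cl jk s j A ε)
    (R : RandomPacking cl jk) {u z η p : ℝ} {B : ℕ} (hR : R.NearlyIndependent u z B η)
    (h0 : 0 ≤ p) (h1 : p ≤ 1) (hpA : p * A ≤ 1) {𝒜 𝒯' : Finset 𝒱}
    {D : Finset P} (hg : Generic cl jk 𝒜 D ∅ 𝒯') (hs : 0 < s)
    (hB : 𝒜.card + 𝒯'.card + (s + j) * D.card ≤ B) :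
    |R.roundProb p 𝒜 D ∅ 𝒯' - (p * (1 - p) ^ (s * A)) ^ D.card *
      (u ^ (𝒜.card + s * D.card) * z ^ (𝒯'.card + j * D.card))| ≤
      p ^ D.card * (η + (B + B ^ 2) * ε) := by
  have hcl := hg.card_claims h
  have hjk := hg.card_junk h
  rw [R.roundProb_empty p fun φ hφ ψ hψ hne =>
    (hg.pairwise φ hφ ψ hψ hne).mono subset_union_left subset_union_left]
  set C := D.biUnion cl with hC
  set N : Finset P := {φ | φ ∉ D ∧ ¬Disjoint (cl φ) C} with hN
  have hmeet : #{φ | ¬Disjoint (cl φ) C} ≤ N.card + D.card := by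
    refine (card_le_card fun φ hφ => ?_).trans (card_union_le N D)
    by_cases hφD : φ ∈ D
    · exact mem_union_right _ hφD
    · exact mem_union_left _ (mem_filter.2 ⟨mem_univ _, hφD, (mem_filter.1 hφ).2⟩)
  have hNle : N.card ≤ D.card * (s * A) := by
    have : N ⊆ ({φ | ¬Disjoint (cl φ) C} : Finset P) := fun φ hφ =>
      mem_filter.2 ⟨mem_univ _, (mem_filter.1 hφ).2.2⟩
    refine (card_le_card this).trans ((h.card_meeting_le C).trans ?_)
    rw [hcl]
    exact le_of_eq (by ring)
  have hNge := h.le_card_meeting C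
  have hpow := one_sub_pow_sub_pow_le h0 h1 hNle
  have hεA := h.one_le
  have hA : (0 : ℝ) < A := by
    rcases Nat.eq_zero_or_pos A with h' | h'
    · simp [h'] at hεA; linarith
    · exact_mod_cast h'
  have hε : 0 ≤ ε := by
    by_contra hcon
    nlinarith
  have hpε : p ≤ ε := by
    have : p * A ≤ ε * A := hpA.trans hεA
    exact le_of_mul_le_mul_right this hA
  have hdB : (D.card : ℝ) ≤ B := by
    have : D.card ≤ B := by nlinarith
    exact_mod_cast this
  have hCB : (C.card : ℝ) ≤ B := by
    have : C.card ≤ B := by rw [hcl]; nlinarith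
    exact_mod_cast this
  have hdiff : ((D.card * (s * A) : ℕ) - N.card : ℝ) * p ≤ (B + B ^ 2) * ε := by
    have e1 : ((D.card * (s * A) : ℕ) : ℝ) = C.card * A := by
      rw [hcl]; push_cast; ring
    have e2 : (#{φ | ¬Disjoint (cl φ) C} : ℝ) ≤ N.card + D.card := by exact_mod_cast hmeet
    have e3 : ((D.card * (s * A) : ℕ) - N.card : ℝ) ≤ B + B ^ 2 * (ε * A) := by
      rw [e1]
      have : (C.card : ℝ) ^ 2 * (ε * A) ≤ B ^ 2 * (ε * A) := by gcongr
      linarith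
    calc ((D.card * (s * A) : ℕ) - N.card : ℝ) * p ≤ (B + B ^ 2 * (ε * A)) * p :=
          mul_le_mul_of_nonneg_right e3 h0
      _ = B * p + B ^ 2 * ε * (p * A) := by ring
      _ ≤ B * ε + B ^ 2 * ε * 1 := by gcongr
      _ = _ := by ring
  have hprob : |pr R.μ (fun ω => 𝒜 ∪ C ⊆ R.free ω ∧ 𝒯' ∪ D.biUnion jk ⊆ R.junk ω) -
      u ^ (𝒜.card + s * D.card) * z ^ (𝒯'.card + j * D.card)| ≤ η := by
    have hd1 : ∀ φ ∈ D, Disjoint (cl φ) 𝒜 ∧ Disjoint (jk φ) 𝒜 ∧ Disjoint (cl φ) 𝒯' ∧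
        Disjoint (jk φ) 𝒯' := fun φ hφ => by
      have := hg.disjoint φ hφ
      simp only [disjoint_union_left, disjoint_union_right] at this
      tauto
    have c1 : (𝒜 ∪ C).card = 𝒜.card + s * D.card := by
      rw [card_union_of_disjoint, hcl]
      exact (disjoint_biUnion_right _ _ _).2 fun φ hφ => (hd1 φ hφ).1.symm
    have c2 : (𝒯' ∪ D.biUnion jk).card = 𝒯'.card + j * D.card := by
      rw [card_union_of_disjoint, hjk]
      exact (disjoint_biUnion_right _ _ _).2 fun φ hφ => (hd1 φ hφ).2.2.2.symm
    rw [← c1, ← c2]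
    refine hR _ _ ?_ (by rw [c1, c2]; linarith)
    simp only [disjoint_union_left, disjoint_union_right, hC, disjoint_biUnion_left,
      disjoint_biUnion_right]
    refine ⟨⟨hg.disjoint₂, fun φ hφ => (hd1 φ hφ).2.2.1⟩, fun φ hφ => ⟨(hd1 φ hφ).2.1.symm,
      fun ψ hψ => ?_⟩⟩
    by_cases e : ψ = φ
    · exact e ▸ h.disjoint φ
    · exact (hg.pairwise ψ hψ φ hφ e).mono subset_union_left subset_union_right
  set q := pr R.μ (fun ω => 𝒜 ∪ C ⊆ R.free ω ∧ 𝒯' ∪ D.biUnion jk ⊆ R.junk ω)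
  set m := u ^ (𝒜.card + s * D.card) * z ^ (𝒯'.card + j * D.card)
  have hq0 : 0 ≤ q := pr_nonneg R.nonneg _
  have hq1 : q ≤ 1 := pr_le_one R.nonneg R.sum_eq_one _
  have e : q * (p ^ D.card * (1 - p) ^ N.card) - (p * (1 - p) ^ (s * A)) ^ D.card * m =
      p ^ D.card * (q * (1 - p) ^ N.card - m * (1 - p) ^ (D.card * (s * A))) := by
    rw [mul_pow, ← pow_mul, mul_comm (s * A)]; ring
  rw [e, abs_mul, abs_of_nonneg (pow_nonneg h0 _)]
  refine mul_le_mul_of_nonneg_left ?_ (pow_nonneg h0 _)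
  refine (abs_mul_sub_mul_le (pow_nonneg (by linarith) _)
    (pow_le_one₀ (by linarith) (by linarith)) hq0 hq1).trans ?_
  linarith

end NibbleIndependence

section NibbleInduction

variable {𝒱 P : Type} [DecidableEq 𝒱] {cl jk : P → Finset 𝒱} {s j A : ℕ} {ε : ℝ}

theorem Generic.insert_left {𝒜 𝒯 𝒯' : Finset 𝒱} {D : Finset P} {T : 𝒱} (hT : T ∉ 𝒯)
    (hg : Generic cl jk 𝒜 D (insert T 𝒯) 𝒯') : Generic cl jk (insert T 𝒜) D 𝒯 𝒯' where
  pairwise := hg.pairwise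
  disjoint φ hφ := by
    have := hg.disjoint φ hφ
    rwa [union_insert, ← insert_union] at this
  disjoint₁ := disjoint_insert_left.2 ⟨hT, hg.disjoint₁.mono_right (subset_insert _ _)⟩
  disjoint₂ := disjoint_insert_left.2
    ⟨disjoint_left.1 hg.disjoint₃ (mem_insert_self _ _), hg.disjoint₂⟩
  disjoint₃ := hg.disjoint₃.mono_left (subset_insert _ _)

variable [DecidableEq P]

/-- The vertices fixed by a list of constraints. -/
def fixedVertices (cl jk : P → Finset 𝒱) (𝒜 : Finset 𝒱) (D : Finset P) (𝒯 𝒯' : Finset 𝒱) :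
    Finset 𝒱 :=
  D.biUnion (fun φ => cl φ ∪ jk φ) ∪ (𝒜 ∪ 𝒯 ∪ 𝒯')

theorem Generic.insert_edge {𝒜 𝒯 𝒯' : Finset 𝒱} {D : Finset P} {φ : P}
    (hg : Generic cl jk 𝒜 D 𝒯 𝒯')
    (hφ : Disjoint (cl φ ∪ jk φ) (fixedVertices cl jk 𝒜 D 𝒯 𝒯')) :
    Generic cl jk 𝒜 (insert φ D) 𝒯 𝒯' := by
  rw [fixedVertices, disjoint_union_right, disjoint_biUnion_right] at hφ
  refine ⟨fun ψ hψ χ hχ hne => ?_, fun ψ hψ => ?_, hg.disjoint₁, hg.disjoint₂, hg.disjoint₃⟩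
  · rcases mem_insert.1 hψ with rfl | h1 <;> rcases mem_insert.1 hχ with rfl | h2
    · exact absurd rfl hne
    · exact hφ.1 χ h2
    · exact (hφ.1 ψ h1).symm
    · exact hg.pairwise ψ h1 χ h2 hne
  · rcases mem_insert.1 hψ with rfl | hψ
    · exact hφ.2
    · exact hg.disjoint ψ hψ

variable [Fintype P]

theorem RandomPacking.abs_roundProb_sub_le (h : IsClaimSystem cl jk s j A ε)
    (R : RandomPacking cl jk) {u z η p X : ℝ} {B : ℕ} (hR : R.NearlyIndependent u z B η)
    (hu0 : 0 ≤ u) (hu1 : u ≤ 1) (hz0 : 0 ≤ z) (hz1 : z ≤ 1)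
    (h0 : 0 ≤ p) (h1 : p ≤ 1) (hpA : p * A ≤ 1) (hs : 0 < s)
    (hX : η + (B + B ^ 2) * ε ≤ X) (hX' : B * ε ≤ X) (𝒯 : Finset 𝒱) :
    ∀ (𝒜 : Finset 𝒱) (D : Finset P) (𝒯' : Finset 𝒱), Generic cl jk 𝒜 D 𝒯 𝒯' →
      𝒜.card + 𝒯'.card + (s + j) * D.card + (1 + s + j) * 𝒯.card ≤ B →
      |R.roundProb p 𝒜 D 𝒯 𝒯' - (p * (1 - p) ^ (s * A)) ^ D.card *
        (u ^ (𝒜.card + s * D.card) * z ^ (𝒯'.card + j * D.card)) *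
        (u - p * A * (1 - p) ^ (s * A) * u ^ s * z ^ j) ^ 𝒯.card| ≤
      p ^ D.card * (3 ^ 𝒯.card * X) := by
  have hεA := h.one_le
  have hε : 0 ≤ ε := by
    by_contra hcon
    have : (0 : ℝ) ≤ A := Nat.cast_nonneg A
    nlinarith
  have hX0 : 0 ≤ X := le_trans (by positivity) hX'
  set κ := (1 - p) ^ (s * A) with hκ
  have hκ0 : 0 ≤ κ := pow_nonneg (by linarith) _
  have hκ1 : κ ≤ 1 := pow_le_one₀ (by linarith) (by linarith)
  set u' := u - p * A * κ * u ^ s * z ^ j with hu'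
  have hus : u ^ s ≤ u := pow_le_of_le_one hu0 hu1 hs.ne'
  have hzj1 : z ^ j ≤ 1 := pow_le_one₀ hz0 hz1
  have hzj0 : 0 ≤ z ^ j := pow_nonneg hz0 _
  have hus0 : 0 ≤ u ^ s := pow_nonneg hu0 _
  have hpA0 : 0 ≤ p * A := by positivity
  have hu'0 : 0 ≤ u' := by
    have : p * A * κ * u ^ s * z ^ j ≤ 1 * 1 * u * 1 := by gcongr
    linarith
  have hu'1 : u' ≤ 1 := by
    have : 0 ≤ p * A * κ * u ^ s * z ^ j := by positivity
    linarith
  induction 𝒯 using Finset.induction_on with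
  | empty =>
    intro 𝒜 D 𝒯' hg hB
    have := R.abs_roundProb_empty_sub_le h hR h0 h1 hpA hg hs (by simpa using hB)
    simp only [card_empty, pow_zero, mul_one, one_mul]
    exact this.trans (mul_le_mul_of_nonneg_left hX (pow_nonneg h0 _))
  | insert T 𝒯 hT ih =>
    intro 𝒜 D 𝒯' hg hB
    rw [card_insert_of_notMem hT] at hB ⊢
    set e := 𝒯.card
    set d := D.card with hd
    have hTA : T ∉ 𝒜 := disjoint_right.1 hg.disjoint₁ (mem_insert_self _ _)
    have hTT' : T ∉ 𝒯' := disjoint_left.1 hg.disjoint₃ (mem_insert_self _ _)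
    have hTsp : ∀ φ ∈ D, T ∉ cl φ ∪ jk φ := fun φ hφ =>
      disjoint_right.1 (hg.disjoint φ hφ) (by simp)
    set W := fixedVertices cl jk 𝒜 D 𝒯 𝒯' with hW
    have hTW : T ∉ W := by
      simp only [hW, fixedVertices, mem_union, mem_biUnion, not_or, not_exists, not_and]
      exact ⟨fun φ hφ => by simpa [not_or] using hTsp φ hφ, ⟨hTA, hT⟩, hTT'⟩
    have hg' : Generic cl jk 𝒜 D 𝒯 𝒯' := ⟨hg.pairwise,
      fun φ hφ => (hg.disjoint φ hφ).mono_right (by gcongr; exact subset_insert _ _),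
      hg.disjoint₁.mono_right (subset_insert _ _), hg.disjoint₂,
      hg.disjoint₃.mono_left (subset_insert _ _)⟩
    have hWB : W.card ≤ B := by
      have h1 : (D.biUnion fun φ => cl φ ∪ jk φ).card ≤ d * (s + j) :=
        card_biUnion_le_card_mul _ _ _ fun φ _ => by
          rw [card_union_of_disjoint (h.disjoint φ), h.card_cl, h.card_jk]
      have h2 := card_union_le (D.biUnion fun φ => cl φ ∪ jk φ) (𝒜 ∪ 𝒯 ∪ 𝒯')
      have h3 := card_union_le (𝒜 ∪ 𝒯) 𝒯'
      have h4 := card_union_le 𝒜 𝒯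
      rw [hW, fixedVertices]
      nlinarith
    rw [R.roundProb_insert]
    set M := (p * κ) ^ (d + 1) * (u ^ (𝒜.card + s * (d + 1)) * z ^ (𝒯'.card + j * (d + 1))) *
      u' ^ e with hM
    have hM0 : 0 ≤ M := by positivity
    have hM1 : M ≤ p ^ (d + 1) := by
      have : M ≤ (p * 1) ^ (d + 1) * (1 * 1) * 1 := by
        rw [hM]
        gcongr
        · exact pow_le_one₀ hu0 hu1
        · exact pow_le_one₀ hz0 hz1
        · exact pow_le_one₀ hu'0 hu'1
      simpa using this
    have hcardD : ∀ φ, T ∈ cl φ → (insert φ D).card = d + 1 := fun φ hφ =>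
      card_insert_of_notMem fun hφD => hTsp φ hφD (mem_union_left _ hφ)
    have hterm : ∀ φ ∈ ({φ | T ∈ cl φ} : Finset P),
        |R.roundProb p 𝒜 (insert φ D) 𝒯 𝒯' - M| ≤ p ^ (d + 1) * (3 ^ e * X) +
          if ¬Disjoint (cl φ ∪ jk φ) W then p ^ (d + 1) else 0 := by
      intro φ hφ
      have hφT := (mem_filter.1 hφ).2
      by_cases hdis : Disjoint (cl φ ∪ jk φ) W
      · have := ih 𝒜 (insert φ D) 𝒯' (hg'.insert_edge hdis)
          (by rw [hcardD φ hφT]; nlinarith)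
        rw [hcardD φ hφT] at this
        simpa [hdis] using this
      · rw [if_pos hdis]
        have h2 := R.roundProb_le h0 h1 𝒜 (insert φ D) 𝒯 𝒯'
        have h3 := R.roundProb_nonneg h0 h1 𝒜 (insert φ D) 𝒯 𝒯'
        rw [hcardD φ hφT] at h2
        have h4 : 0 ≤ p ^ (d + 1) * (3 ^ e * X) := by positivity
        rw [abs_le]
        constructor <;> linarith
    have hsum : |∑ φ with T ∈ cl φ, R.roundProb p 𝒜 (insert φ D) 𝒯 𝒯' - A * M| ≤
        p ^ d * (3 ^ e * X + B * ε) := by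
      have e1 : (A * M : ℝ) = ∑ φ with T ∈ cl φ, M := by
        rw [sum_const, h.degree T, nsmul_eq_mul]
      rw [e1, ← sum_sub_distrib]
      refine (abs_sum_le_sum_abs _ _).trans ((sum_le_sum hterm).trans ?_)
      rw [sum_add_distrib, sum_const, h.degree T, nsmul_eq_mul, ← sum_filter, filter_filter,
        sum_const, nsmul_eq_mul]
      have hbad : (#{φ | T ∈ cl φ ∧ ¬Disjoint (cl φ ∪ jk φ) W} : ℝ) ≤ B * (ε * A) := by
        refine (h.card_codegree_le T hTW).trans ?_
        gcongr
      calc (A * (p ^ (d + 1) * (3 ^ e * X)) +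
            #{φ | T ∈ cl φ ∧ ¬Disjoint (cl φ ∪ jk φ) W} * p ^ (d + 1) : ℝ)
          ≤ A * (p ^ (d + 1) * (3 ^ e * X)) + B * (ε * A) * p ^ (d + 1) := by gcongr
        _ = p ^ d * ((p * A) * (3 ^ e * X + B * ε)) := by ring
        _ ≤ p ^ d * (1 * (3 ^ e * X + B * ε)) := by gcongr
        _ = _ := by ring
    have hfirst := ih (insert T 𝒜) D 𝒯' (hg.insert_left hT)
      (by rw [card_insert_of_notMem hTA]; nlinarith)
    rw [card_insert_of_notMem hTA, ← hd] at hfirst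
    set M₁ := (p * κ) ^ d * (u ^ (𝒜.card + 1 + s * d) * z ^ (𝒯'.card + j * d)) * u' ^ e with hM₁
    have hrec : (p * κ) ^ d * (u ^ (𝒜.card + s * d) * z ^ (𝒯'.card + j * d)) * u' ^ (e + 1) =
        M₁ - A * M := by
      rw [hM₁, hM, pow_succ u' e, hu']
      ring
    rw [hrec]
    have hsplit : ∀ a b c f : ℝ, a - b - (c - f) = (a - c) - (b - f) := fun _ _ _ _ => by ring
    rw [hsplit]
    refine (abs_sub _ _).trans ((add_le_add hfirst hsum).trans ?_)
    have h3 : X ≤ 3 ^ e * X := le_mul_of_one_le_left hX0 (one_le_pow₀ (by norm_num))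
    rw [← mul_add]
    refine mul_le_mul_of_nonneg_left ?_ (pow_nonneg h0 _)
    rw [pow_succ]
    linarith

theorem RandomPacking.NearlyIndependent.nibble (h : IsClaimSystem cl jk s j A ε)
    {R : RandomPacking cl jk} {u z η p : ℝ} {E B : ℕ} (hB : B = (1 + s + j) * E)
    (hη : 0 ≤ η) (hR : R.NearlyIndependent u z B η)
    (hu0 : 0 ≤ u) (hu1 : u ≤ 1) (hz0 : 0 ≤ z) (hz1 : z ≤ 1)
    (h0 : 0 ≤ p) (h1 : p ≤ 1) (hpA : p * A ≤ 1) (hs : 0 < s) :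
    (R.nibble p h0 h1).NearlyIndependent (u - p * A * (1 - p) ^ (s * A) * u ^ s * z ^ j) z E
      (3 ^ E * (η + (B + B ^ 2) * ε)) := by
  intro 𝒯 𝒯' hdis hE
  have hεA := h.one_le
  have hε : 0 ≤ ε := by
    by_contra hcon
    have : (0 : ℝ) ≤ A := Nat.cast_nonneg A
    nlinarith
  have hX' : B * ε ≤ η + (B + B ^ 2) * ε := by
    have : 0 ≤ (B : ℝ) ^ 2 * ε := by positivity
    linarith
  have := R.abs_roundProb_sub_le h hR hu0 hu1 hz0 hz1 h0 h1 hpA hs le_rfl hX' 𝒯 ∅ ∅ 𝒯'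
    ⟨by simp, by simp, by simp, by simp, hdis⟩ (by simp; nlinarith)
  simp only [card_empty, pow_zero, mul_zero, one_mul, add_zero] at this
  have hround : R.roundProb p ∅ ∅ 𝒯 𝒯' = pr (R.nibble p h0 h1).μ
      (fun x => 𝒯 ⊆ (R.nibble p h0 h1).free x ∧ 𝒯' ⊆ (R.nibble p h0 h1).junk x) := by
    simp only [roundProb, empty_subset, notMem_empty, false_imp_iff, implies_true, true_and]
    rfl
  rw [hround, mul_comm (z ^ _)] at this
  refine this.trans ?_
  have : (0 : ℝ) ≤ η + (B + B ^ 2) * ε := by positivity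
  gcongr
  · norm_num
  · omega

end NibbleInduction

theorem RandomPacking.NearlyIndependent.mono {𝒱 P : Type} [DecidableEq 𝒱] {cl jk : P → Finset 𝒱}
    {R : RandomPacking cl jk} {u z η η' : ℝ} {E E' : ℕ} (h : R.NearlyIndependent u z E η)
    (hE : E' ≤ E) (hη : η ≤ η') : R.NearlyIndependent u z E' η' :=
  fun 𝒯 𝒯' hd hc => (h 𝒯 𝒯' hd (hc.trans hE)).trans hη

theorem RandomPacking.MomentBound.mono {𝒱 P : Type} [DecidableEq 𝒱] {cl jk : P → Finset 𝒱}
    {R : RandomPacking cl jk} {a a' : ℝ} (h : R.MomentBound a) (ha : 0 ≤ a) (haa' : a ≤ a') :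
    R.MomentBound a' :=
  fun D => (h D).trans (pow_le_pow_left₀ ha haa' _)

/-- In every claim system with small codegrees there is a random packing that leaves each vertex
free with probability at most about `u`, has junk probability about `z`, and chooses each edge with
probability proportional to `1 / A`. -/
def Reaches (s j : ℕ) (z u : ℝ) : Prop :=
  ∃ c : ℝ, 0 ≤ c ∧ ∀ (E : ℕ) (η : ℝ), 0 < η → ∃ ε₀ : ℝ, 0 < ε₀ ∧
    ∀ (𝒱 P : Type) [Fintype 𝒱] [DecidableEq 𝒱] [Fintype P] [DecidableEq P] (cl jk : P → Finset 𝒱)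
      (A : ℕ) (ε : ℝ), IsClaimSystem cl jk s j A ε → ε ≤ ε₀ →
      ∃ (R : RandomPacking cl jk) (v : ℝ), 0 ≤ v ∧ v ≤ u ∧ R.NearlyIndependent v z E η ∧
        R.MomentBound (c / A)

theorem Reaches.mono {s j : ℕ} {z u u' : ℝ} (h : Reaches s j z u) (hu : u ≤ u') :
    Reaches s j z u' := by
  obtain ⟨c, hc, h⟩ := h
  refine ⟨c, hc, fun E η hη => ?_⟩
  obtain ⟨ε₀, hε₀, h⟩ := h E η hη
  refine ⟨ε₀, hε₀, fun 𝒱 P _ _ _ _ cl jk A ε hsys hε => ?_⟩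
  obtain ⟨R, v, hv0, hvu, hR⟩ := h 𝒱 P cl jk A ε hsys hε
  exact ⟨R, v, hv0, hvu.trans hu, hR⟩

/-- The packing with no chosen edges, in which each vertex is junk with probability `z`. -/
noncomputable def initialPacking {𝒱 P : Type} [Fintype 𝒱] [DecidableEq 𝒱] (cl jk : P → Finset 𝒱)
    (z : ℝ) (hz0 : 0 ≤ z) (hz1 : z ≤ 1) : RandomPacking cl jk where
  Ω := Finset 𝒱
  fintype := inferInstance
  μ := bernoulliWeight z
  nonneg := bernoulliWeight_nonneg hz0 hz1
  sum_eq_one := sum_bernoulliWeight z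
  free S := Sᶜ
  junk S := S
  chosen _ := ∅
  disjoint_free_junk _ := disjoint_compl_left
  disjoint_free := by simp
  disjoint_junk := by simp
  subset_junk := by simp
  pairwise := by simp
  cover S T := by
    by_cases h : T ∈ S <;> simp [h]

theorem reaches_one_sub (s j : ℕ) {z : ℝ} (hz0 : 0 ≤ z) (hz1 : z ≤ 1) :
    Reaches s j z (1 - z) := by
  refine ⟨0, le_rfl, fun E η hη => ⟨1, one_pos, fun 𝒱 P _ _ _ _ cl jk A ε _ _ =>
    ⟨initialPacking cl jk z hz0 hz1, 1 - z, by linarith, le_rfl, fun 𝒯 𝒯' hd _ => ?_,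
      fun D => ?_⟩⟩⟩
  · have := pr_bernoulliWeight z hd.symm
    have e : pr (initialPacking cl jk z hz0 hz1).μ (fun ω =>
        𝒯 ⊆ (initialPacking cl jk z hz0 hz1).free ω ∧
          𝒯' ⊆ (initialPacking cl jk z hz0 hz1).junk ω) =
        pr (bernoulliWeight z) (fun S => 𝒯' ⊆ S ∧ Disjoint 𝒯 S) := by
      refine congrArg (pr (bernoulliWeight z)) (funext fun S => propext ?_)
      exact (and_comm.trans (and_congr_right fun _ => subset_compl_iff_disjoint_right))
    rw [e, this, mul_comm, sub_self, abs_zero]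
    exact hη.le
  · rcases D.eq_empty_or_nonempty with rfl | hD
    · simpa using pr_le_one (initialPacking cl jk z hz0 hz1).nonneg
        (initialPacking cl jk z hz0 hz1).sum_eq_one _
    · rw [zero_div, zero_pow hD.card_pos.ne']
      refine le_of_eq (sum_eq_zero fun ω _ => if_neg fun h => ?_)
      exact hD.ne_empty (subset_empty.1 h)

theorem Reaches.step {s j : ℕ} {z u τ : ℝ} (h : Reaches s j z u) (hs : 0 < s) (hz0 : 0 ≤ z)
    (hz1 : z ≤ 1) (hu1 : u ≤ 1) (hτ : 0 ≤ τ) :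
    Reaches s j z (max τ (u - τ ^ s * z ^ j / (4 * s))) := by
  obtain ⟨c, hc, h⟩ := h
  have hs' : (1 : ℝ) ≤ s := by exact_mod_cast hs
  set δ : ℝ := 1 / (2 * s) with hδ
  have hδ0 : 0 < δ := by positivity
  have hδ1 : δ ≤ 1 := by
    rw [hδ, div_le_one (by positivity)]
    linarith
  have hδs : δ * s = 1 / 2 := by
    rw [hδ]
    field_simp
  refine ⟨c + δ, by positivity, fun E η hη => ?_⟩
  set B := (1 + s + j) * E with hB
  set η' := η / (2 * 3 ^ E) with hη'
  have hη'0 : 0 < η' := by positivity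
  have hη'η : 3 ^ E * (η' + η') = η := by
    rw [hη']
    field_simp
    ring
  obtain ⟨ε₀, hε₀, h⟩ := h B η' hη'0
  have hden : (0 : ℝ) < B + B ^ 2 + 1 := by positivity
  refine ⟨min ε₀ (η' / (B + B ^ 2 + 1)), lt_min hε₀ (div_pos hη'0 hden),
    fun 𝒱 P _ _ _ _ cl jk A ε hsys hε => ?_⟩
  obtain ⟨R, v, hv0, hvu, hR, hM⟩ := h 𝒱 P cl jk A ε hsys (hε.trans (min_le_left _ _))
  have hεA := hsys.one_le
  have hA : 0 < A := by
    rcases Nat.eq_zero_or_pos A with h' | h'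
    · simp [h'] at hεA; linarith
    · exact h'
  have hA1 : (1 : ℝ) ≤ A := by exact_mod_cast hA
  have hA0 : (0 : ℝ) < A := by linarith
  rcases le_or_gt v τ with hvτ | hvτ
  · refine ⟨R, v, hv0, hvτ.trans (le_max_left _ _), hR.mono ?_ ?_,
      hM.mono (by positivity) (by gcongr; linarith)⟩
    · rw [hB]; nlinarith
    · have : (1 : ℝ) ≤ 3 ^ E := one_le_pow₀ (by norm_num)
      nlinarith
  · set p := δ / A with hp
    have h0 : 0 ≤ p := by positivity
    have h1 : p ≤ 1 := by
      rw [hp, div_le_one hA0]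
      linarith
    have hpA : p * A = δ := div_mul_cancel₀ _ hA0.ne'
    have hv1 : v ≤ 1 := hvu.trans hu1
    have hNI := hR.nibble hsys hB hη'0.le hv0 hv1 hz0 hz1 h0 h1 (by linarith) hs
    set κ := (1 - p) ^ (s * A) with hκ
    have hκ2 : 1 / 2 ≤ κ := by
      have := one_add_mul_le_pow (a := -p) (by linarith) (s * A)
      rw [← sub_eq_add_neg] at this
      refine le_trans (le_of_eq ?_) this
      push_cast
      have : (s * A * -p : ℝ) = -(δ * s) := by rw [← hpA]; ring
      rw [this, hδs]
      norm_num
    have hκ0 : 0 ≤ κ := by linarith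
    have hκ1 : κ ≤ 1 := pow_le_one₀ (by linarith) (by linarith)
    have hzj0 : 0 ≤ z ^ j := pow_nonneg hz0 _
    have hzj1 : z ^ j ≤ 1 := pow_le_one₀ hz0 hz1
    have hvs : v ^ s ≤ v := pow_le_of_le_one hv0 hv1 hs.ne'
    refine ⟨R.nibble p h0 h1, _, ?_, ?_, hNI.mono le_rfl ?_, ?_⟩
    · rw [hpA]
      have : δ * κ * v ^ s * z ^ j ≤ 1 * 1 * v * 1 := by gcongr
      linarith
    · refine le_trans ?_ (le_max_right _ _)
      rw [hpA]
      have : δ * (1 / 2) * τ ^ s * z ^ j ≤ δ * κ * v ^ s * z ^ j := by gcongr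
      have e : τ ^ s * z ^ j / (4 * s) = δ * (1 / 2) * τ ^ s * z ^ j := by
        rw [hδ]; field_simp; ring
      rw [e]
      linarith
    · rw [← hη'η]
      have : (B + B ^ 2 : ℝ) * ε ≤ η' := by
        have h2 : ε ≤ η' / (B + B ^ 2 + 1) := hε.trans (min_le_right _ _)
        calc (B + B ^ 2 : ℝ) * ε ≤ (B + B ^ 2) * (η' / (B + B ^ 2 + 1)) := by gcongr
          _ ≤ (B + B ^ 2 + 1) * (η' / (B + B ^ 2 + 1)) :=
            mul_le_mul_of_nonneg_right (by linarith) (by positivity)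
          _ = η' := mul_div_cancel₀ _ hden.ne'
      gcongr
    · rw [add_div]
      exact hM.nibble h0 h1

theorem reaches_of_pos {s j : ℕ} {z τ : ℝ} (hs : 0 < s) (hz0 : 0 < z) (hz1 : z ≤ 1) (hτ : 0 < τ)
    (hτ1 : τ ≤ 1) : Reaches s j z τ := by
  set g := τ ^ s * z ^ j / (4 * s) with hg
  have hg0 : 0 < g := by positivity
  have key : ∀ i : ℕ, Reaches s j z (max τ (1 - z - i * g)) := by
    intro i
    induction i with
    | zero => exact (reaches_one_sub s j hz0.le hz1).mono (by simp)
    | succ i ih =>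
      have hi : 0 ≤ i * g := by positivity
      refine (ih.step hs hz0.le hz1 (max_le hτ1 (by linarith)) hτ.le).mono ?_
      rw [← hg]
      refine max_le (le_max_left _ _) ?_
      rcases max_cases τ (1 - z - i * g) with ⟨e, -⟩ | ⟨e, -⟩ <;> rw [e]
      · exact le_trans (by linarith) (le_max_left _ _)
      · refine le_trans (le_of_eq ?_) (le_max_right _ _)
        push_cast
        ring
  obtain ⟨i, hi⟩ := exists_nat_gt ((1 - z) / g)
  refine (key i).mono (max_le le_rfl ?_)
  rw [div_lt_iff₀ hg0] at hi
  linarith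

theorem IsClaimSystem.card_le_sum_mul_card_chosen {𝒱 P : Type} [Fintype 𝒱] [DecidableEq 𝒱]
    [Fintype P] {cl jk : P → Finset 𝒱} {s j A : ℕ} {ε : ℝ}
    (h : IsClaimSystem cl jk s j A ε) (R : RandomPacking cl jk) {v z η : ℝ} {E : ℕ} (hE : 1 ≤ E)
    (hR : R.NearlyIndependent v z E η) :
    (1 - v - z - 2 * η) * Fintype.card 𝒱 ≤ s * ∑ ω, R.μ ω * (R.chosen ω).card := by
  have hfree : ∀ T, pr R.μ (fun ω => T ∈ R.free ω) ≤ v + η := fun T => by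
    have := hR {T} ∅ (by simp) (by simpa using hE)
    simp only [singleton_subset_iff, empty_subset, and_true, card_singleton, pow_one, card_empty,
      pow_zero, mul_one] at this
    linarith [(abs_le.1 this).2]
  have hjunk : ∀ T, pr R.μ (fun ω => T ∈ R.junk ω) ≤ z + η := fun T => by
    have := hR ∅ {T} (by simp) (by simpa using hE)
    simp only [singleton_subset_iff, empty_subset, true_and, card_singleton, pow_one, card_empty,
      pow_zero, one_mul] at this
    linarith [(abs_le.1 this).2]
  have hcover : ∀ ω, (Fintype.card 𝒱 : ℝ) ≤
      (R.free ω).card + (R.junk ω).card + s * (R.chosen ω).card := by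
    intro ω
    have hsub : (univ : Finset 𝒱) ⊆ R.free ω ∪ R.junk ω ∪ (R.chosen ω).biUnion cl := by
      intro T _
      simp only [mem_union, mem_biUnion]
      have := R.cover ω T
      tauto
    have h1 := card_le_card hsub
    have h2 := card_union_le (R.free ω ∪ R.junk ω) ((R.chosen ω).biUnion cl)
    have h3 := card_union_le (R.free ω) (R.junk ω)
    have h4 : ((R.chosen ω).biUnion cl).card ≤ (R.chosen ω).card * s :=
      card_biUnion_le_card_mul _ _ _ fun φ _ => (h.card_cl φ).le
    rw [card_univ] at h1
    have : Fintype.card 𝒱 ≤ (R.free ω).card + (R.junk ω).card + s * (R.chosen ω).card := by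
      linarith
    exact_mod_cast this
  have hsum : (Fintype.card 𝒱 : ℝ) ≤ ∑ ω, R.μ ω * (R.free ω).card +
      ∑ ω, R.μ ω * (R.junk ω).card + s * ∑ ω, R.μ ω * (R.chosen ω).card := by
    rw [mul_sum, ← sum_add_distrib, ← sum_add_distrib, ← one_mul (Fintype.card 𝒱 : ℝ),
      ← R.sum_eq_one, sum_mul]
    refine sum_le_sum fun ω _ => ?_
    have := mul_le_mul_of_nonneg_left (hcover ω) (R.nonneg ω)
    linarith
  have e1 : ∑ ω, R.μ ω * (R.free ω).card ≤ Fintype.card 𝒱 * (v + η) := by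
    rw [sum_mul_card_eq_sum_pr]
    refine (sum_le_sum fun T _ => hfree T).trans (le_of_eq ?_)
    rw [sum_const, card_univ, nsmul_eq_mul]
  have e2 : ∑ ω, R.μ ω * (R.junk ω).card ≤ Fintype.card 𝒱 * (z + η) := by
    rw [sum_mul_card_eq_sum_pr]
    refine (sum_le_sum fun T _ => hjunk T).trans (le_of_eq ?_)
    rw [sum_const, card_univ, nsmul_eq_mul]
  linarith

theorem exists_sum_mul_le {Ω : Type*} [Fintype Ω] {μ : Ω → ℝ} (hμ : ∀ ω, 0 ≤ μ ω)
    (h1 : ∑ ω, μ ω = 1) (f : Ω → ℝ) : ∃ ω, ∑ ω, μ ω * f ω ≤ f ω := by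
  have hne : (univ : Finset Ω).Nonempty := by
    by_contra h
    rw [not_nonempty_iff_eq_empty] at h
    simp [h] at h1
  obtain ⟨ω, -, hω⟩ := exists_max_image univ f hne
  refine ⟨ω, ?_⟩
  calc ∑ ω', μ ω' * f ω' ≤ ∑ ω', μ ω' * f ω :=
        sum_le_sum fun ω' _ => mul_le_mul_of_nonneg_left (hω ω' (mem_univ _)) (hμ ω')
    _ = f ω := by rw [← sum_mul, h1, one_mul]

/-- The alteration method: removing one element from each bad subset of a random set. -/
theorem exists_subset_avoiding {Ω P : Type*} [Fintype Ω] [Fintype P] {μ : Ω → ℝ}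
    (hμ : ∀ ω, 0 ≤ μ ω) (h1 : ∑ ω, μ ω = 1) (X : Ω → Finset P) (Bad : Finset (Finset P))
    (hne : ∀ D ∈ Bad, D.Nonempty) :
    ∃ ω, ∃ F ⊆ X ω, (∀ D ∈ Bad, ¬D ⊆ F) ∧
      ∑ ω, μ ω * (X ω).card - ∑ D ∈ Bad, pr μ (fun ω => D ⊆ X ω) ≤ F.card := by
  classical
  obtain ⟨ω, hω⟩ := exists_sum_mul_le hμ h1
    fun ω => ((X ω).card : ℝ) - #{D ∈ Bad | D ⊆ X ω}
  have hex : ∀ D, ∃ s : Finset P, s.card ≤ 1 ∧ (D ∈ Bad → ∃ x ∈ s, x ∈ D) := by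
    intro D
    by_cases hD : D ∈ Bad
    · obtain ⟨x, hx⟩ := hne D hD
      exact ⟨{x}, by simp, fun _ => ⟨x, by simp, hx⟩⟩
    · exact ⟨∅, by simp, fun h => absurd h hD⟩
  choose f hf hf' using hex
  refine ⟨ω, X ω \ ({D ∈ Bad | D ⊆ X ω} : Finset _).biUnion f, sdiff_subset, fun D hD hDF => ?_, ?_⟩
  · obtain ⟨x, hx, hxD⟩ := hf' D hD
    exact (mem_sdiff.1 (hDF hxD)).2 (mem_biUnion.2
      ⟨D, mem_filter.2 ⟨hD, hDF.trans sdiff_subset⟩, hx⟩)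
  · have e : ∑ ω, μ ω * (((X ω).card : ℝ) - #{D ∈ Bad | D ⊆ X ω}) =
        ∑ ω, μ ω * (X ω).card - ∑ D ∈ Bad, pr μ (fun ω => D ⊆ X ω) := by
      simp only [pr, mul_sub, sum_sub_distrib]
      rw [sum_comm (s := Bad)]
      congr 1
      refine sum_congr rfl fun ω _ => ?_
      rw [card_filter, Nat.cast_sum, mul_sum]
      refine sum_congr rfl fun D _ => ?_
      by_cases h : D ⊆ X ω <;> simp [h]
    rw [← e]
    refine hω.trans ?_
    have h3 := le_card_sdiff (({D ∈ Bad | D ⊆ X ω} : Finset _).biUnion f) (X ω)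
    have h4 : (({D ∈ Bad | D ⊆ X ω} : Finset _).biUnion f).card ≤ #{D ∈ Bad | D ⊆ X ω} :=
      (card_biUnion_le_card_mul _ _ 1 fun D _ => hf D).trans (mul_one _).le
    have h5 : (X ω).card ≤ (X ω \ ({D ∈ Bad | D ⊆ X ω} : Finset _).biUnion f).card +
        #{D ∈ Bad | D ⊆ X ω} := by omega
    have h6 : ((X ω).card : ℝ) ≤ (X ω \ ({D ∈ Bad | D ⊆ X ω} : Finset _).biUnion f).card +
        #{D ∈ Bad | D ⊆ X ω} := by exact_mod_cast h5
    linarith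

theorem card_maps_with_small_image_le {X V : Type*} [Fintype X] [DecidableEq X] [Fintype V]
    [DecidableEq V] [Nonempty V] (R : Finset V) (v : ℕ) :
    #{h : X → V | #(univ.image h \ R) ≤ v} ≤ Fintype.card V ^ v * (#R + v) ^ Fintype.card X := by
  have hc : Fintype.card ((Fin v → V) × (X → R ⊕ Fin v)) =
      Fintype.card V ^ v * (#R + v) ^ Fintype.card X := by simp
  rw [← hc, ← card_univ]
  refine card_le_card_of_surjOn (fun x y => Sum.elim (fun a : R => (a : V)) x.1 (x.2 y)) ?_
  intro h hh
  have hh : #(univ.image h \ R) ≤ v := (mem_filter.1 hh).2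
  obtain ⟨g, hg⟩ : ∃ g : Fin v → V, ∀ y ∈ univ.image h \ R, ∃ i, g i = y := by
    have ⟨g⟩ : Nonempty ((univ.image h \ R : Finset V) ↪ Fin v) :=
      Function.Embedding.nonempty_of_card_le 
        (by rw [Fintype.card_coe, Fintype.card_fin]; exact hh)
    refine ⟨Function.extend g (fun y => y.1) fun _ => Classical.arbitrary V, fun y hy =>
      ⟨g ⟨y, hy⟩, g.injective.extend_apply _ _ _⟩⟩
  have hx : ∀ x, ∃ y : R ⊕ Fin v, Sum.elim (fun a : R => (a : V)) g y = h x := by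
    intro x
    by_cases hR : h x ∈ R
    · exact ⟨Sum.inl ⟨h x, hR⟩, rfl⟩
    · obtain ⟨i, hi⟩ := hg (h x) (mem_sdiff.2 ⟨mem_image_of_mem _ (mem_univ _), hR⟩)
      exact ⟨Sum.inr i, hi⟩
  choose y hy using hx
  exact ⟨(g, y), by simp, funext hy⟩

/-- The vertices used by a placement. -/
def placed {W V : Type*} [Fintype W] (φ : W ↪ V) : Finset V := univ.map φ

theorem card_placed {W V : Type*} [Fintype W] (φ : W ↪ V) : #(placed φ) = Fintype.card W := by
  simp [placed]

/-- Any `q ≤ Q` of the placements in `F` share at most `(q - 1) k` vertices. -/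
def SparsePlacements {W V : Type*} [Fintype W] [DecidableEq V] (k Q : ℕ) (F : Finset (W ↪ V)) :
    Prop :=
  ∀ D ⊆ F, D.Nonempty → #D ≤ Q → #D * Fintype.card W ≤ #(D.biUnion placed) + (#D - 1) * k

theorem card_small_unions_le {W V : Type*} [Fintype W] [DecidableEq W] [Fintype V] [DecidableEq V]
    [Nonempty V] (q v : ℕ) :
    #{D : Finset (W ↪ V) | #D = q ∧ #(D.biUnion placed) ≤ v} ≤
      Fintype.card V ^ v * v ^ (q * Fintype.card W) := by
  have h := card_maps_with_small_image_le (X := Fin q × W) (∅ : Finset V) v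
  simp only [card_empty, zero_add, Fintype.card_prod, Fintype.card_fin, sdiff_empty] at h
  refine le_trans ?_ h
  have hex : ∀ D : {D : Finset (W ↪ V) // #D = q}, ∃ g : Fin q → (W ↪ V), univ.image g = D.1 := by
    rintro ⟨D, rfl⟩
    refine ⟨fun i => (D.equivFin.symm i).1, ?_⟩
    ext φ
    simp only [mem_image, mem_univ, true_and]
    exact ⟨fun ⟨i, hi⟩ => hi ▸ (D.equivFin.symm i).2,
      fun hφ => ⟨D.equivFin ⟨φ, hφ⟩, by simp⟩⟩
  choose g hg using hex
  refine card_le_card_of_forall_subsingleton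
    (fun D h => ∃ hD : #D = q, h = fun x => g ⟨D, hD⟩ x.1 x.2) ?_ ?_
  · intro D hD
    obtain ⟨-, hq, hv⟩ := mem_filter.1 hD
    refine ⟨_, mem_filter.2 ⟨mem_univ _, ?_⟩, hq, rfl⟩
    refine (card_le_card ?_).trans hv
    intro y hy
    obtain ⟨x, -, rfl⟩ := mem_image.1 hy
    refine mem_biUnion.2 ⟨g ⟨D, hq⟩ x.1, ?_, by simp [placed]⟩
    have h2 := mem_image_of_mem (g ⟨D, hq⟩) (mem_univ x.1)
    rwa [hg] at h2
  · rintro h - D ⟨-, hD, e⟩ D' ⟨-, hD', e'⟩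
    have : g ⟨D, hD⟩ = g ⟨D', hD'⟩ := by
      funext i
      ext x
      exact congrFun (e.symm.trans e') (i, x)
    have h1 := hg ⟨D, hD⟩
    rw [this, hg] at h1
    exact h1.symm

theorem exists_sparse_placements (W : Type*) [Fintype W] [DecidableEq W] {k : ℕ} (hk : 0 < k)
    (hkw : k < Fintype.card W) (Q : ℕ) {c : ℝ} (hc : 0 ≤ c) :
    ∃ C : ℝ, 0 ≤ C ∧ ∀ (n : ℕ), 0 < n → ∀ (Ω : Type) [Fintype Ω] (μ : Ω → ℝ)
      (X : Ω → Finset (W ↪ Fin n)), (∀ ω, 0 ≤ μ ω) → ∑ ω, μ ω = 1 →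
      (∀ D, pr μ (fun ω => D ⊆ X ω) ≤ (c / n ^ (Fintype.card W - k)) ^ #D) →
      ∃ ω, ∃ F ⊆ X ω, SparsePlacements k Q F ∧
        ∑ ω, μ ω * (X ω).card - C * n ^ (k - 1) ≤ F.card := by
  set w := Fintype.card W
  refine ⟨∑ q ∈ Icc 1 Q, c ^ q * (((w - k) * q + (k - 1) : ℕ) : ℝ) ^ (q * w),
    sum_nonneg fun q _ => by positivity, fun n hn Ω _ μ X hμ h1 hX => ?_⟩
  have : Nonempty (Fin n) := ⟨⟨0, hn⟩⟩
  have hn0 : (0 : ℝ) < n := by exact_mod_cast hn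
  set Bad : Finset (Finset (W ↪ Fin n)) :=
    {D | #D ∈ Icc 1 Q ∧ #(D.biUnion placed) + (#D - 1) * k < #D * w} with hBad
  obtain ⟨ω, F, hF, hFBad, hcard⟩ := exists_subset_avoiding hμ h1 X Bad fun D hD =>
    card_pos.1 (mem_Icc.1 (mem_filter.1 hD).2.1).1
  refine ⟨ω, F, hF, fun D hDF hne hDQ => ?_, ?_⟩
  · by_contra hcon
    refine hFBad D (mem_filter.2 ⟨mem_univ _, mem_Icc.2 ⟨hne.card_pos, hDQ⟩, ?_⟩) hDF
    exact not_le.1 hcon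
  · refine le_trans (sub_le_sub_left ?_ _) hcard
    rw [← sum_fiberwise_of_maps_to (s := Bad) (t := Icc 1 Q) (g := fun D => #D)
      fun D hD => (mem_filter.1 hD).2.1, sum_mul]
    refine sum_le_sum fun q hq => ?_
    set v := (w - k) * q + (k - 1) with hv
    have hq1 := (mem_Icc.1 hq).1
    have hcount : #{D ∈ Bad | #D = q} ≤ n ^ v * v ^ (q * w) := by
      have h2 := card_small_unions_le (W := W) (V := Fin n) q v
      rw [Fintype.card_fin] at h2
      refine (card_le_card fun D hD => ?_).trans h2
      obtain ⟨hD, hDq⟩ := mem_filter.1 hD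
      refine mem_filter.2 ⟨mem_univ _, hDq, ?_⟩
      have h3 := (mem_filter.1 hD).2.2
      rw [hDq] at h3
      obtain ⟨l, hl⟩ := Nat.exists_eq_add_of_lt hkw
      obtain ⟨q, rfl⟩ := Nat.exists_eq_add_of_le' hq1
      have e1 : w - k = l + 1 := by omega
      rw [hv, e1]
      change w = k + l + 1 at hl
      rw [hl] at h3
      simp only [Nat.add_sub_cancel] at h3
      have : (q + 1) * (k + l + 1) = q * k + k + (l + 1) * (q + 1) := by ring
      omega
    calc ∑ D ∈ Bad with #D = q, pr μ (fun ω => D ⊆ X ω)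
        ≤ ∑ D ∈ Bad with #D = q, (c / n ^ (w - k)) ^ q :=
          sum_le_sum fun D hD => (mem_filter.1 hD).2 ▸ hX D
      _ = #{D ∈ Bad | #D = q} * (c / n ^ (w - k)) ^ q := by rw [sum_const, nsmul_eq_mul]
      _ ≤ ((n ^ v * v ^ (q * w) : ℕ) : ℝ) * (c / n ^ (w - k)) ^ q := by gcongr
      _ = c ^ q * (v : ℝ) ^ (q * w) * n ^ (k - 1) := by
          rw [div_pow, ← pow_mul, hv]
          push_cast
          rw [pow_add]
          field_simp

theorem pow_le_two_pow_mul_descFactorial {m w : ℕ} (h : 2 * w ≤ m) :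
    m ^ w ≤ 2 ^ w * m.descFactorial w := by
  calc m ^ w ≤ (2 * (m + 1 - w)) ^ w := Nat.pow_le_pow_left (by omega) _
    _ = 2 ^ w * (m + 1 - w) ^ w := mul_pow _ _ _
    _ ≤ 2 ^ w * m.descFactorial w := Nat.mul_le_mul_left _ (Nat.pow_sub_le_descFactorial _ _)

theorem exists_many_sparse_placements (W : Type) [Fintype W] [DecidableEq W] {k : ℕ} (hk : 0 < k)
    (hkw : k < Fintype.card W) (Q : ℕ) {K : ℝ} (hK : 0 < K) :
    ∃ m : ℕ, 0 < m ∧ ∃ F : Finset (W ↪ Fin m), SparsePlacements k Q F ∧ K * m ^ k ≤ #F := by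
  set w := Fintype.card W with hw
  set c : ℝ := 2 ^ w * (K + 1) with hc
  have hc0 : 0 ≤ c := by positivity
  obtain ⟨C, -, hC⟩ := exists_sparse_placements W hk hkw Q hc0
  obtain ⟨m₀, hm₀⟩ := exists_nat_ge (max c C)
  set m := m₀ + 2 * w + 1 with hm
  have hmm : (m₀ : ℝ) ≤ m := by exact_mod_cast (by omega : m₀ ≤ m)
  have hmc : c ≤ m := (le_max_left _ _).trans (hm₀.trans hmm)
  have hmC : C ≤ m := (le_max_right _ _).trans (hm₀.trans hmm)
  have hm0 : 0 < m := by omega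
  have hm1 : (1 : ℝ) ≤ m := by exact_mod_cast hm0
  have hmpos : (0 : ℝ) < m := by linarith
  set p := c / m ^ (w - k) with hp
  have hp0 : 0 ≤ p := by positivity
  have hp1 : p ≤ 1 := by
    rw [hp, div_le_one (by positivity)]
    exact hmc.trans (le_self_pow₀ hm1 (by omega))
  obtain ⟨ω, F, -, hF, hcard⟩ := hC m hm0 (Finset (W ↪ Fin m)) (bernoulliWeight p) id
    (bernoulliWeight_nonneg hp0 hp1) (sum_bernoulliWeight p)
    fun D => (pr_bernoulliWeight_subset p D).le
  refine ⟨m, hm0, F, hF, le_trans ?_ hcard⟩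
  have hexp : ∑ S : Finset (W ↪ Fin m), bernoulliWeight p S * (#(id S) : ℝ) =
      ((m.descFactorial w : ℕ) : ℝ) * p := by
    rw [sum_mul_card_eq_sum_pr]
    have : ∀ φ : W ↪ Fin m, pr (bernoulliWeight p) (fun S => φ ∈ id S) = p := fun φ => by
      simpa using pr_bernoulliWeight_subset p {φ}
    rw [sum_congr rfl fun φ _ => this φ, sum_const, card_univ, Fintype.card_embedding_eq,
      Fintype.card_fin, nsmul_eq_mul]
  rw [hexp]
  have h1 : (m : ℝ) ^ w ≤ 2 ^ w * (m.descFactorial w : ℕ) := by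
    exact_mod_cast pow_le_two_pow_mul_descFactorial (by omega : 2 * w ≤ m)
  have h2 : (K + 1) * m ^ k ≤ (m.descFactorial w : ℕ) * p := by
    have e : (m : ℝ) ^ w = m ^ k * m ^ (w - k) := by rw [← pow_add]; congr 1; omega
    rw [hp, hc, mul_div_assoc', le_div_iff₀ (by positivity), mul_assoc, ← e]
    nlinarith
  have h3 : C * m ^ (k - 1) ≤ (m : ℝ) ^ k := by
    obtain ⟨l, rfl⟩ := Nat.exists_eq_add_of_le' hk
    rw [Nat.add_sub_cancel, pow_succ']
    gcongr
  linarith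

/-- A configuration of edges of size `r`, each with a private vertex, in which any `q ≤ Q` edges
share at most `(q - 1) k` vertices. -/
structure IsCluster {W ι : Type*} [DecidableEq W] (k r Q : ℕ) (e : ι → Finset W) : Prop where
  card : ∀ i, #(e i) = r
  exists_private : ∀ i, ∃ x ∈ e i, ∀ i', x ∈ e i' → i' = i
  sparse : ∀ X : Finset ι, X.Nonempty → #X ≤ Q → #X * r ≤ #(X.biUnion e) + (#X - 1) * k

/-- The edges obtained from placements by adding a private vertex to each. -/
def extendedEdge {W V : Type*} [Fintype W] (F : Finset (W ↪ V)) (φ : F) :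
    Finset (V ⊕ F) :=
  (placed φ.1).disjSum {φ}

theorem isCluster_extendedEdge {W V : Type*} [Fintype W] [DecidableEq W] [DecidableEq V]
    {k Q : ℕ} {F : Finset (W ↪ V)} [DecidableEq F] (hF : SparsePlacements k Q F) :
    IsCluster k (Fintype.card W + 1) Q (extendedEdge F) where
  card φ := by simp [extendedEdge, card_disjSum, card_placed]
  exists_private φ := ⟨Sum.inr φ, by simp [extendedEdge], by simp [extendedEdge, eq_comm]⟩
  sparse X hX hQ := by
    have h := hF (X.map (Function.Embedding.subtype _)) (fun φ hφ => by
      obtain ⟨ψ, -, rfl⟩ := mem_map.1 hφ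
      exact ψ.2) (by simpa using hX) (by simpa using hQ)
    have e : X.biUnion (extendedEdge F) =
        ((X.map (Function.Embedding.subtype _)).biUnion placed).disjSum X := by
      ext x
      rcases x with x | φ <;> simp [extendedEdge]
    rw [e, card_disjSum]
    rw [card_map] at h
    linarith

theorem card_shadow_extendedEdge_le {W : Type*} [Fintype W] [DecidableEq W] {m k : ℕ}
    (hk : 0 < k) (F : Finset (W ↪ Fin m)) [DecidableEq F] :
    #{S | #S = k ∧ ∃ φ, S ⊆ extendedEdge F φ} ≤ #F * (Fintype.card W).choose (k - 1) + m ^ k := by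
  have hsub : ({S | #S = k ∧ ∃ φ, S ⊆ extendedEdge F φ} : Finset (Finset (Fin m ⊕ F))) ⊆
      ((univ : Finset F).biUnion fun φ => (powersetCard (k - 1) (placed φ.1)).image
        fun S => S.disjSum {φ}) ∪
      (powersetCard k (univ : Finset (Fin m))).image fun S => S.map Function.Embedding.inl := by
    intro S hS
    obtain ⟨-, hSk, φ, hφ⟩ := mem_filter.1 hS
    have hl : S.toLeft ⊆ placed φ.1 := fun x hx => by
      simpa [extendedEdge] using hφ (mem_toLeft.1 hx)
    have hr : S.toRight ⊆ {φ} := fun x hx => by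
      simpa [extendedEdge] using hφ (mem_toRight.1 hx)
    have hc := S.card_toLeft_add_card_toRight
    rw [mem_union]
    rcases subset_singleton_iff.1 hr with h | h
    · right
      refine mem_image.2 ⟨S.toLeft, mem_powersetCard.2 ⟨subset_univ _, ?_⟩, ?_⟩
      · rw [h, card_empty] at hc
        omega
      · conv_rhs => rw [← S.toLeft_disjSum_toRight, h]
        simp
    · left
      refine mem_biUnion.2 ⟨φ, mem_univ _, mem_image.2 ⟨S.toLeft, mem_powersetCard.2 ⟨hl, ?_⟩, ?_⟩⟩
      · rw [h, card_singleton] at hc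
        omega
      · conv_rhs => rw [← S.toLeft_disjSum_toRight, h]
  refine (card_le_card hsub).trans ((card_union_le _ _).trans (add_le_add ?_ ?_))
  · refine (card_biUnion_le_card_mul _ _ ((Fintype.card W).choose (k - 1)) fun φ _ => ?_).trans ?_
    · refine card_image_le.trans ?_
      rw [card_powersetCard, card_placed]
    · simp
  · refine card_image_le.trans ?_
    rw [card_powersetCard, card_univ, Fintype.card_fin]
    exact Nat.choose_le_pow _ _

theorem exists_cluster {k r : ℕ} (hk : 0 < k) (hkr : k + 2 ≤ r) (Q : ℕ) {ε : ℝ} (hε : 0 < ε) :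
    ∃ (W ι : Type) (_ : Fintype W) (_ : DecidableEq W) (_ : Fintype ι) (e : ι → Finset W),
      Nonempty ι ∧ IsCluster k r Q e ∧
      (#{S | #S = k ∧ ∃ i, S ⊆ e i} : ℝ) ≤ ((r - 1).choose (k - 1) + ε) * Fintype.card ι := by
  classical
  obtain ⟨m, hm, F, hF, hcard⟩ := exists_many_sparse_placements (Fin (r - 1)) hk
    (by rw [Fintype.card_fin]; omega) Q (K := 1 / ε) (by positivity)
  have hm' : (0 : ℝ) < m := by exact_mod_cast hm
  have h := isCluster_extendedEdge hF
  rw [Fintype.card_fin, Nat.sub_add_cancel (by omega)] at h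
  refine ⟨Fin m ⊕ F, F, inferInstance, inferInstance, inferInstance, extendedEdge F, ?_, h, ?_⟩
  · have : (0 : ℝ) < #F := lt_of_lt_of_le (by positivity) hcard
    obtain ⟨φ, hφ⟩ := card_pos.1 (Nat.cast_pos.1 this)
    exact ⟨⟨φ, hφ⟩⟩
  · have h2 := card_shadow_extendedEdge_le hk F
    rw [Fintype.card_fin] at h2
    have h3 : (#{S | #S = k ∧ ∃ φ, S ⊆ extendedEdge F φ} : ℝ) ≤
        #F * (r - 1).choose (k - 1) + m ^ k := by exact_mod_cast h2
    rw [one_div, inv_mul_le_iff₀ hε] at hcard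
    rw [Fintype.card_coe]
    linarith

/-- The copy of the edge `x.2` under the placement `x.1`. -/
def copyEdge {W ι V : Type*} (e : ι → Finset W) (x : (W ↪ V) × ι) : Finset V := (e x.2).map x.1

theorem copyEdge_subset_placed {W ι V : Type*} [Fintype W] (e : ι → Finset W) (x : (W ↪ V) × ι) :
    copyEdge e x ⊆ placed x.1 := map_subset_map.2 (subset_univ _)

theorem IsCluster.card_copyEdge {W ι V : Type*} [DecidableEq W] {e : ι → Finset W} {k r Q : ℕ}
    (he : IsCluster k r Q e) (x : (W ↪ V) × ι) :
    #(copyEdge e x) = r := by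
  rw [copyEdge, card_map, he.card]

theorem IsCluster.exists_private_copy {W ι V : Type*} [DecidableEq W] {e : ι → Finset W}
    {k r Q : ℕ} (he : IsCluster k r Q e) (x : (W ↪ V) × ι) :
    ∃ v ∈ copyEdge e x, ∀ y : (W ↪ V) × ι, y.1 = x.1 → v ∈ copyEdge e y → y = x := by
  obtain ⟨w, hw, hw'⟩ := he.exists_private x.2
  refine ⟨x.1 w, mem_map_of_mem _ hw, fun y hy hwy => Prod.ext hy (hw' _ ?_)⟩
  rw [copyEdge, hy] at hwy
  exact (mem_map' _).1 hwy

section Copies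

variable {W ι V : Type*} [Fintype W] [DecidableEq W] [DecidableEq V] {e : ι → Finset W}
  {F : Finset (W ↪ V)} {k r Q : ℕ}

theorem IsCluster.copyEdge_injOn (he : IsCluster k r Q e) (hkr : k ≤ r)
    (hF : ∀ φ ∈ F, ∀ ψ ∈ F, φ ≠ ψ → ∀ i, #((e i).map φ ∩ placed ψ) < k)
    {x y : (W ↪ V) × ι} (hx : x.1 ∈ F) (hy : y.1 ∈ F) (hxy : copyEdge e x = copyEdge e y) :
    x = y := by
  by_cases h : x.1 = y.1
  · obtain ⟨v, hv, hv'⟩ := he.exists_private_copy y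
    exact hv' x h (hxy ▸ hv)
  · have h1 := hF _ hx _ hy h x.2
    have h2 : copyEdge e x ⊆ placed y.1 := hxy ▸ copyEdge_subset_placed e y
    change #(copyEdge e x ∩ placed y.1) < k at h1
    rw [inter_eq_left.2 h2, he.card_copyEdge] at h1
    omega

theorem IsCluster.le_card_biUnion_copyEdge [DecidableEq ι] (he : IsCluster k r Q e)
    (hF : SparsePlacements k Q F) {X : Finset ((W ↪ V) × ι)} (hXF : ∀ x ∈ X, x.1 ∈ F)
    (hX : X.Nonempty) (hXQ : #X ≤ Q) :
    #X * r ≤ #(X.biUnion (copyEdge e)) + (#X - 1) * k := by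
  classical
  set D := X.image Prod.fst with hD
  set I : (W ↪ V) → Finset ι := fun φ => ({x ∈ X | x.1 = φ} : Finset _).image Prod.snd with hI
  have hmemI : ∀ φ i, i ∈ I φ ↔ (φ, i) ∈ X := by
    intro φ i
    simp only [hI, mem_image, mem_filter, Prod.exists, exists_eq_right]
  have hIcard : ∑ φ ∈ D, #(I φ) = #X := by
    rw [card_eq_sum_card_image Prod.fst X]
    refine sum_congr rfl fun φ _ => card_image_of_injOn fun x hx y hy hxy => ?_
    have h1 := (mem_filter.1 (mem_coe.1 hx)).2
    have h2 := (mem_filter.1 (mem_coe.1 hy)).2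
    exact Prod.ext (h1.trans h2.symm) hxy
  have hDX : #D ≤ #X := card_image_le
  have hDne : D.Nonempty := hX.image _
  have hplaced := hF D (fun φ hφ => by
    obtain ⟨x, hx, rfl⟩ := mem_image.1 hφ
    exact hXF x hx) hDne (hDX.trans hXQ)
  have hone : ∀ φ ∈ D, #(I φ) * r ≤ #((I φ).biUnion e) + (#(I φ) - 1) * k ∧ 1 ≤ #(I φ) := by
    intro φ hφ
    obtain ⟨x, hx, rfl⟩ := mem_image.1 hφ
    have hne : (I x.1).Nonempty := ⟨x.2, (hmemI _ _).2 hx⟩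
    refine ⟨he.sparse _ hne (le_trans ?_ hXQ), hne.card_pos⟩
    exact card_image_le.trans (card_filter_le _ _)
  have hsub : D.biUnion placed ⊆ X.biUnion (copyEdge e) ∪
      D.biUnion fun φ => (univ \ (I φ).biUnion e).map φ := by
    intro v hv
    obtain ⟨φ, hφ, hv⟩ := mem_biUnion.1 hv
    obtain ⟨w, -, rfl⟩ := mem_map.1 hv
    by_cases hw : w ∈ (I φ).biUnion e
    · obtain ⟨i, hi, hwi⟩ := mem_biUnion.1 hw
      exact mem_union_left _ (mem_biUnion.2 ⟨(φ, i), (hmemI _ _).1 hi, mem_map_of_mem _ hwi⟩)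
    · exact mem_union_right _ (mem_biUnion.2
        ⟨φ, hφ, mem_map_of_mem _ (mem_sdiff.2 ⟨mem_univ _, hw⟩)⟩)
  have h1 : #(D.biUnion placed) ≤ #(X.biUnion (copyEdge e)) +
      ∑ φ ∈ D, (Fintype.card W - #((I φ).biUnion e)) := by
    refine (card_le_card hsub).trans ((card_union_le _ _).trans ?_)
    refine Nat.add_le_add_left (card_biUnion_le.trans (le_of_eq (sum_congr rfl fun φ _ => ?_))) _
    rw [card_map, card_sdiff_of_subset (subset_univ _), card_univ]
  have h2 : ∑ φ ∈ D, (Fintype.card W - #((I φ).biUnion e)) + ∑ φ ∈ D, #(I φ) * r + #D * k ≤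
      #D * Fintype.card W + ∑ φ ∈ D, #(I φ) * k := by
    rw [← sum_add_distrib, ← smul_eq_mul #D, ← smul_eq_mul #D, ← sum_const, ← sum_const,
      ← sum_add_distrib, ← sum_add_distrib]
    refine sum_le_sum fun φ hφ => ?_
    obtain ⟨h3, h4⟩ := hone φ hφ
    have h5 : #((I φ).biUnion e) ≤ Fintype.card W := card_le_univ _
    obtain ⟨l, hl⟩ := Nat.exists_eq_add_of_le' h4
    rw [hl, Nat.add_sub_cancel] at h3
    rw [hl]
    have : (l + 1) * k = l * k + k := by ring
    omega
  rw [← sum_mul, ← sum_mul, hIcard] at h2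
  obtain ⟨d, hd⟩ : ∃ d, #D = d + 1 := ⟨#D - 1, (Nat.succ_pred_eq_of_pos hDne.card_pos).symm⟩
  obtain ⟨l, hl⟩ : ∃ l, #X = l + 1 := ⟨#X - 1, (Nat.succ_pred_eq_of_pos hX.card_pos).symm⟩
  rw [hd, Nat.add_sub_cancel] at hplaced
  rw [hd, hl] at h2
  rw [hl, Nat.add_sub_cancel]
  have e1 : (l + 1) * k = l * k + k := by ring
  have e2 : (d + 1) * k = d * k + k := by ring
  omega

theorem IsCluster.isCancellative_image_copyEdge [Fintype ι] {t : ℕ} (ht : 0 < t) (hk : 0 < k)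
    (he : IsCluster k (t * k) (2 * t) e) (hFs : SparsePlacements k (2 * t) F)
    (hF : ∀ φ ∈ F, ∀ ψ ∈ F, φ ≠ ψ → ∀ i, #((e i).map φ ∩ placed ψ) < k) :
    IsCancellative (2 * (t - 1)) ((F ×ˢ univ).image (copyEdge e)) := by
  classical
  intro 𝒜 h𝒜 h𝒜t B hB C hC hBA hCA hBC hsub
  obtain ⟨x, hx, rfl⟩ := mem_image.1 hB
  obtain ⟨y, hy, rfl⟩ := mem_image.1 hC
  obtain ⟨A, hA, rfl⟩ := subset_image_iff.1 h𝒜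
  have hxF := (mem_product.1 hx).1
  have hyF := (mem_product.1 hy).1
  have hAF : ∀ a ∈ A, a.1 ∈ F := fun a ha => (mem_product.1 (hA ha)).1
  have hkr : k ≤ t * k := Nat.le_mul_of_pos_left k ht
  have hcardA : #(A.image (copyEdge e)) = #A := card_image_of_injOn fun a ha b hb hab =>
    he.copyEdge_injOn hkr hF (hAF a ha) (hAF b hb) hab
  rw [hcardA] at h𝒜t
  have hxA : x ∉ A := fun h => hBA (mem_image_of_mem _ h)
  have hyA : y ∉ A := fun h => hCA (mem_image_of_mem _ h)
  have hxy : x ≠ y := fun h => hBC (h ▸ rfl)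
  have hsub' : ∀ v, v ∈ copyEdge e x → v ∉ copyEdge e y → ∃ a ∈ A, v ∈ copyEdge e a := by
    intro v h1 h2
    have := hsub (mem_union_left _ (mem_sdiff.2 ⟨h1, h2⟩))
    simpa using this
  have hsub'' : ∀ v, v ∈ copyEdge e y → v ∉ copyEdge e x → ∃ a ∈ A, v ∈ copyEdge e a := by
    intro v h1 h2
    have := hsub (mem_union_right _ (mem_sdiff.2 ⟨h1, h2⟩))
    simpa using this
  have hkey : ∀ A' ⊆ A, (#A' + 2) * (t * k) ≤
      #((insert x (insert y A')).biUnion (copyEdge e)) + (#A' + 1) * k := by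
    intro A' hA'
    have hy' : y ∉ A' := fun h => hyA (hA' h)
    have hx' : x ∉ insert y A' := by
      rw [mem_insert, not_or]
      exact ⟨hxy, fun h => hxA (hA' h)⟩
    have hc : #(insert x (insert y A')) = #A' + 2 := by
      rw [card_insert_of_notMem hx', card_insert_of_notMem hy']
    have hA'c := card_le_card hA'
    have := he.le_card_biUnion_copyEdge hFs (X := insert x (insert y A')) (by
      intro z hz
      rcases mem_insert.1 hz with rfl | hz
      · exact hxF
      rcases mem_insert.1 hz with rfl | hz
      · exact hyF
      · exact hAF z (hA' hz)) (insert_nonempty _ _) (by omega)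
    rwa [hc] at this
  have hunion : ∀ A' : Finset ((W ↪ V) × ι), #(A'.biUnion (copyEdge e)) ≤ #A' * (t * k) :=
    fun A' => card_biUnion_le_card_mul _ _ _ fun a _ => (he.card_copyEdge a).le
  obtain ⟨m, hm⟩ : ∃ m, m = #(copyEdge e x ∩ copyEdge e y) := ⟨_, rfl⟩
  have hmk : m ≤ k := by
    have h1 := hkey ∅ (empty_subset _)
    simp only [card_empty, zero_add, one_mul, biUnion_insert, biUnion_empty, union_empty] at h1
    have h2 := card_union_add_card_inter (copyEdge e x) (copyEdge e y)
    rw [he.card_copyEdge, he.card_copyEdge] at h2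
    omega
  have hfull : 2 * (t * k) ≤ m + (#A + 1) * k := by
    have h1 := hkey A subset_rfl
    have h2 : (insert x (insert y A)).biUnion (copyEdge e) ⊆
        (copyEdge e x ∩ copyEdge e y) ∪ A.biUnion (copyEdge e) := by
      intro v hv
      simp only [biUnion_insert, mem_union, mem_inter, mem_biUnion] at hv ⊢
      rcases hv with hv | hv | hv
      · by_cases h : v ∈ copyEdge e y
        exacts [Or.inl ⟨hv, h⟩, Or.inr (hsub' v hv h)]
      · by_cases h : v ∈ copyEdge e x
        exacts [Or.inl ⟨h, hv⟩, Or.inr (hsub'' v hv h)]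
      · exact Or.inr hv
    have h3 := (card_le_card h2).trans (card_union_le _ _)
    have h4 := hunion A
    have : (#A + 2) * (t * k) = #A * (t * k) + 2 * (t * k) := by ring
    omega
  have hAt : #A + 2 = 2 * t := by
    by_contra hne
    have h1 : #A + 2 + 1 ≤ 2 * t := by omega
    have h2 : (#A + 2 + 1) * k ≤ 2 * t * k := Nat.mul_le_mul_right k h1
    have h3 : (#A + 2 + 1) * k = (#A + 1) * k + 2 * k := by ring
    rw [← mul_assoc] at hfull
    omega
  have hfst : y.1 = x.1 := by
    by_contra hne
    have h1 := hF _ hxF _ hyF (Ne.symm hne) x.2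
    have h2 : m ≤ #((e x.2).map x.1 ∩ placed y.1) :=
      hm.trans_le (card_le_card (inter_subset_inter_left (copyEdge_subset_placed e y)))
    have h3 : (#A + 2) * k = 2 * t * k := by rw [hAt]
    have h4 : (#A + 2) * k = (#A + 1) * k + k := by ring
    rw [← mul_assoc] at hfull
    omega
  obtain ⟨v, hvx, hv⟩ := he.exists_private_copy x
  obtain ⟨a, haA, hva⟩ := hsub' v hvx fun h => hxy (hv y hfst h).symm
  have hax : a.1 ≠ x.1 := fun h => hxA (hv a h hva ▸ haA)
  set A₁ := {a ∈ A | a.1 = x.1} with hA₁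
  set A₂ := {a ∈ A | ¬a.1 = x.1} with hA₂
  have hA₁₂ : #A₁ + #A₂ = #A := card_filter_add_card_filter_not _
  have hA₂pos : 0 < #A₂ := card_pos.2 ⟨a, mem_filter.2 ⟨haA, hax⟩⟩
  have h1 := hkey A₁ (filter_subset _ _)
  have h2 : (insert x (insert y A₁)).biUnion (copyEdge e) ⊆
      (copyEdge e x ∩ copyEdge e y) ∪ A₁.biUnion (copyEdge e) ∪
        A₂.biUnion fun a => copyEdge e a ∩ placed x.1 := by
    intro v hv
    have hmem : ∀ a ∈ A, v ∈ copyEdge e a → v ∈ placed x.1 →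
        v ∈ A₁.biUnion (copyEdge e) ∨ v ∈ A₂.biUnion fun a => copyEdge e a ∩ placed x.1 := by
      intro a ha hva hvx
      by_cases h : a.1 = x.1
      · exact Or.inl (mem_biUnion.2 ⟨a, mem_filter.2 ⟨ha, h⟩, hva⟩)
      · exact Or.inr (mem_biUnion.2 ⟨a, mem_filter.2 ⟨ha, h⟩, mem_inter.2 ⟨hva, hvx⟩⟩)
    simp only [biUnion_insert, mem_union, mem_inter] at hv ⊢
    have hyx := copyEdge_subset_placed e y
    rw [hfst] at hyx
    rcases hv with hv | hv | hv
    · by_cases h : v ∈ copyEdge e y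
      · exact Or.inl (Or.inl ⟨hv, h⟩)
      · obtain ⟨a, ha, hva⟩ := hsub' v hv h
        exact (hmem a ha hva (copyEdge_subset_placed e x hv)).imp_left Or.inr
    · by_cases h : v ∈ copyEdge e x
      · exact Or.inl (Or.inl ⟨h, hv⟩)
      · obtain ⟨a, ha, hva⟩ := hsub'' v hv h
        exact (hmem a ha hva (hyx hv)).imp_left Or.inr
    · exact Or.inl (Or.inr hv)
  have h3 : #(A₂.biUnion fun a => copyEdge e a ∩ placed x.1) ≤ #A₂ * (k - 1) :=
    card_biUnion_le_card_mul _ _ _ fun a ha =>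
      Nat.le_sub_one_of_lt (hF _ (hAF a (mem_filter.1 ha).1) _ hxF (mem_filter.1 ha).2 a.2)
  have h4 := (card_le_card h2).trans (card_union_le _ _)
  have h5 := card_union_le (copyEdge e x ∩ copyEdge e y) (A₁.biUnion (copyEdge e))
  have h6 := hunion A₁
  obtain ⟨l, rfl⟩ : ∃ l, k = l + 1 := ⟨k - 1, (Nat.succ_pred_eq_of_pos hk).symm⟩
  rw [Nat.add_sub_cancel] at h3
  have h7 : (#A₁ + #A₂ + 2) * (l + 1) = 2 * t * (l + 1) := by rw [hA₁₂, hAt]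
  have h8 : (#A₁ + #A₂ + 2) * (l + 1) = (#A₁ + 1) * (l + 1) + #A₂ * l + #A₂ + (l + 1) := by ring
  have h9 : (#A₁ + 2) * (t * (l + 1)) = #A₁ * (t * (l + 1)) + 2 * t * (l + 1) := by ring
  omega

end Copies

section ShadowImages

variable {W V : Type*} [Fintype V] [DecidableEq V] {k : ℕ} {𝒮 : Finset (Finset W)}

/-- The `k`-subsets of `V` that are images of members of `𝒮` under `φ`. -/
def kImages (k : ℕ) (𝒮 : Finset (Finset W)) (φ : W ↪ V) : Finset {T : Finset V // #T = k} :=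
  {T | ∃ S ∈ 𝒮, S.map φ = T.1}

theorem mem_kImages {φ : W ↪ V} {T : {T : Finset V // #T = k}} :
    T ∈ kImages k 𝒮 φ ↔ ∃ S ∈ 𝒮, S.map φ = T.1 := by
  simp [kImages]

theorem card_kImages (h𝒮 : ∀ S ∈ 𝒮, #S = k) (φ : W ↪ V) : #(kImages k 𝒮 φ) = #𝒮 := by
  symm
  refine card_bij (fun S hS => ⟨S.map φ, (card_map φ).trans (h𝒮 S hS)⟩) ?_ ?_ ?_
  · exact fun S hS => mem_kImages.2 ⟨S, hS, rfl⟩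
  · exact fun S _ S' _ h => map_injective φ (Subtype.ext_iff.1 h)
  · intro T hT
    obtain ⟨S, hS, h⟩ := mem_kImages.1 hT
    exact ⟨S, hS, Subtype.ext h⟩

theorem disjoint_kImages {𝒮' : Finset (Finset W)} (h : Disjoint 𝒮 𝒮') (φ : W ↪ V) :
    Disjoint (kImages k 𝒮 φ) (kImages k 𝒮' φ) := by
  rw [disjoint_left] at h ⊢
  intro T hT hT'
  obtain ⟨S, hS, hST⟩ := mem_kImages.1 hT
  obtain ⟨S', hS', hST'⟩ := mem_kImages.1 hT'
  exact h hS (map_injective φ (hST.trans hST'.symm) ▸ hS')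

variable [Fintype W]

theorem subset_placed_of_mem_kImages {φ : W ↪ V} {T : {T : Finset V // #T = k}}
    (hT : T ∈ kImages k 𝒮 φ) : T.1 ⊆ placed φ := by
  obtain ⟨S, -, hS⟩ := mem_kImages.1 hT
  rw [← hS]
  exact map_subset_map.2 (subset_univ _)

theorem mem_kImages_union_compl [DecidableEq W] {φ : W ↪ V} {T : {T : Finset V // #T = k}} :
    T ∈ kImages k 𝒮 φ ∪ kImages k (powersetCard k univ \ 𝒮) φ ↔ T.1 ⊆ placed φ := by
  refine ⟨fun h => ?_, fun h => ?_⟩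
  · rcases mem_union.1 h with h | h <;> exact subset_placed_of_mem_kImages h
  · obtain ⟨S, -, hS⟩ := subset_map_iff.1 h
    have hSk : #S = k := by rw [← T.2, hS, card_map]
    by_cases hS𝒮 : S ∈ 𝒮
    · exact mem_union_left _ (mem_kImages.2 ⟨S, hS𝒮, hS.symm⟩)
    · exact mem_union_right _ (mem_kImages.2
        ⟨S, mem_sdiff.2 ⟨mem_powersetCard.2 ⟨subset_univ _, hSk⟩, hS𝒮⟩, hS.symm⟩)

theorem card_filter_mem_kImages_le [DecidableEq W] (T T' : {T : Finset V // #T = k}) :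
    #{φ : W ↪ V | T ∈ kImages k 𝒮 φ} ≤ #{φ : W ↪ V | T' ∈ kImages k 𝒮 φ} := by
  obtain ⟨σ, hσ⟩ := exists_perm_map_eq (T.2.trans T'.2.symm)
  refine card_le_card_of_injOn (fun φ => φ.trans σ.toEmbedding) ?_ ?_
  · intro φ hφ
    obtain ⟨S, hS, h⟩ := mem_kImages.1 (mem_filter.1 (mem_coe.1 hφ)).2
    refine mem_coe.2 (mem_filter.2 ⟨mem_univ _, mem_kImages.2 ⟨S, hS, ?_⟩⟩)
    rw [← map_map, h, hσ]
  · intro φ _ ψ _ h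
    ext x
    exact σ.injective (DFunLike.congr_fun h x)

theorem sum_card_filter_mem_kImages [DecidableEq W] (h𝒮 : ∀ S ∈ 𝒮, #S = k) :
    ∑ T : {T : Finset V // #T = k}, #{φ : W ↪ V | T ∈ kImages k 𝒮 φ} =
      (Fintype.card V).descFactorial (Fintype.card W) * #𝒮 := by
  calc ∑ T : {T : Finset V // #T = k}, #{φ : W ↪ V | T ∈ kImages k 𝒮 φ}
      = ∑ φ : W ↪ V, #{T : {T : Finset V // #T = k} | T ∈ kImages k 𝒮 φ} :=
        sum_card_bipartiteAbove_eq_sum_card_bipartiteBelow fun T φ => T ∈ kImages k 𝒮 φ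
    _ = ∑ φ : W ↪ V, #𝒮 := sum_congr rfl fun φ _ => by
        rw [filter_univ_mem, card_kImages h𝒮]
    _ = _ := by rw [sum_const, card_univ, Fintype.card_embedding_eq, smul_eq_mul]

theorem card_filter_placed_le [DecidableEq W] {T T' : {T : Finset V // #T = k}} (hT : T ≠ T')
    (hk : k < Fintype.card W) :
    #{φ : W ↪ V | T.1 ⊆ placed φ ∧ T'.1 ⊆ placed φ} ≤
      Fintype.card V ^ (Fintype.card W - k - 1) *
        (2 * k + Fintype.card W) ^ Fintype.card W := by
  set w := Fintype.card W with hw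
  have hU : k < #(T.1 ∪ T'.1) := by
    by_contra! h
    have h1 := eq_of_subset_of_card_le subset_union_left (h.trans T.2.ge)
    have h2 := eq_of_subset_of_card_le subset_union_right (h.trans T'.2.ge)
    exact hT (Subtype.ext (h1.trans h2.symm))
  have hU' : #(T.1 ∪ T'.1) ≤ 2 * k := by
    have := card_union_le T.1 T'.1
    rw [T.2, T'.2] at this
    omega
  have : Nonempty V := by
    obtain ⟨v, -⟩ := card_pos.1 (Nat.zero_lt_of_lt hU)
    exact ⟨v⟩
  calc #{φ : W ↪ V | T.1 ⊆ placed φ ∧ T'.1 ⊆ placed φ}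
      ≤ #{h : W → V | #(univ.image h \ (T.1 ∪ T'.1)) ≤ w - k - 1} := by
        refine card_le_card_of_injOn (fun φ => φ) ?_ DFunLike.coe_injective.injOn
        intro φ hφ
        obtain ⟨h1, h2⟩ := (mem_filter.1 (mem_coe.1 hφ)).2
        refine mem_coe.2 (mem_filter.2 ⟨mem_univ _, ?_⟩)
        have himage : univ.image φ = placed φ := (map_eq_image _ _).symm
        rw [himage, card_sdiff_of_subset (union_subset h1 h2), card_placed]
        omega
    _ ≤ Fintype.card V ^ (w - k - 1) * (#(T.1 ∪ T'.1) + (w - k - 1)) ^ w :=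
        card_maps_with_small_image_le _ _
    _ ≤ _ := by
        gcongr
        omega

end ShadowImages

theorem exists_isClaimSystem {W : Type} [Fintype W] [DecidableEq W] {k n : ℕ}
    {𝒮 : Finset (Finset W)} (h𝒮 : ∀ S ∈ 𝒮, #S = k) (hne : 𝒮.Nonempty)
    (hk : k < Fintype.card W) (hn : 2 * Fintype.card W ≤ n) :
    ∃ A : ℕ, n ^ (Fintype.card W - k) ≤ 2 ^ Fintype.card W * A ∧
      IsClaimSystem (kImages k 𝒮 : (W ↪ Fin n) → Finset {T : Finset (Fin n) // #T = k})
        (kImages k (powersetCard k univ \ 𝒮)) #𝒮 #(powersetCard k univ \ 𝒮) A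
        (2 ^ Fintype.card W * (2 * k + Fintype.card W) ^ Fintype.card W / n) := by
  set w := Fintype.card W with hw
  have hn0 : 0 < n := by omega
  have hdeg : ∃ A, ∀ T : {T : Finset (Fin n) // #T = k},
      #{φ : W ↪ Fin n | T ∈ kImages k 𝒮 φ} = A := by
    obtain ⟨T₀, -, hT₀⟩ := exists_subset_card_eq (s := (univ : Finset (Fin n))) (n := k) (by
      rw [card_univ, Fintype.card_fin]; omega)
    exact ⟨_, fun T => (card_filter_mem_kImages_le T ⟨T₀, hT₀⟩).antisymm
      (card_filter_mem_kImages_le _ _)⟩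
  obtain ⟨A, hA⟩ := hdeg
  have hcount := sum_card_filter_mem_kImages (V := Fin n) h𝒮
  simp_rw [hA] at hcount
  rw [sum_const, card_univ, Fintype.card_finset_len, Fintype.card_fin, smul_eq_mul] at hcount
  have hAn : n ^ (w - k) ≤ 2 ^ w * A := by
    refine Nat.le_of_mul_le_mul_left ?_ (pow_pos hn0 k)
    calc n ^ k * n ^ (w - k) = n ^ w := by rw [← pow_add, Nat.add_sub_cancel' hk.le]
      _ ≤ 2 ^ w * n.descFactorial w := pow_le_two_pow_mul_descFactorial hn
      _ ≤ 2 ^ w * (n.descFactorial w * #𝒮) :=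
          Nat.mul_le_mul_left _ (Nat.le_mul_of_pos_right _ hne.card_pos)
      _ = n.choose k * (2 ^ w * A) := by rw [← hcount]; ring
      _ ≤ n ^ k * (2 ^ w * A) := Nat.mul_le_mul_right _ (Nat.choose_le_pow n k)
  have hεA : (n : ℝ) ^ (w - k - 1) * (2 * k + w) ^ w ≤
      2 ^ w * (2 * k + w) ^ w / n * A := by
    have h1 : (n : ℝ) ^ (w - k) ≤ 2 ^ w * A := by exact_mod_cast hAn
    have h2 : (n : ℝ) ^ (w - k) = n ^ (w - k - 1) * n := by
      rw [← pow_succ, Nat.sub_add_cancel (by omega)]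
    have hn' : (0 : ℝ) < n := by exact_mod_cast hn0
    rw [h2] at h1
    rw [div_mul_eq_mul_div, le_div_iff₀ hn']
    calc (n : ℝ) ^ (w - k - 1) * (2 * k + w) ^ w * n
        = (n ^ (w - k - 1) * n) * (2 * k + w) ^ w := by ring
      _ ≤ (2 ^ w * A) * (2 * k + w) ^ w := by gcongr
      _ = _ := by ring
  refine ⟨A, hAn, card_kImages h𝒮, card_kImages fun S hS => ?_,
    disjoint_kImages disjoint_sdiff, hA, fun T T' hT => ?_, ?_⟩
  · exact (mem_powersetCard.1 (mem_sdiff.1 hS).1).2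
  · simp_rw [mem_kImages_union_compl]
    refine le_trans ?_ hεA
    have := card_filter_placed_le (W := W) hT hk
    rw [Fintype.card_fin] at this
    exact_mod_cast this
  · refine le_trans ?_ hεA
    have h1 : 0 < n ^ (w - k - 1) * (2 * k + w) ^ w :=
      Nat.mul_pos (pow_pos hn0 _) (pow_pos (by omega) _)
    exact_mod_cast Nat.one_le_iff_ne_zero.2 h1.ne'

theorem IsCancellative.card_le_maxCancellative {t n r : ℕ} {H : Finset (Finset (Fin n))}
    (hH : IsCancellative t H) (hr : ∀ e ∈ H, #e = r) : #H ≤ maxCancellative t n r := by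
  refine le_csSup ⟨Fintype.card (Finset (Fin n)), ?_⟩ ⟨H, hr, hH, rfl⟩
  rintro _ ⟨H', -, -, rfl⟩
  exact card_le_univ H'

theorem maxCancellative_mul_choose_le {t k : ℕ} (ht : 0 < t) (hk : 0 < k) (n : ℕ) :
    maxCancellative (2 * (t - 1)) n (t * k) * (t * k - 1).choose (k - 1) ≤ n.choose k := by
  have hb : 0 < (t * k - 1).choose (k - 1) :=
    Nat.choose_pos (Nat.sub_le_sub_right (Nat.le_mul_of_pos_left k ht) 1)
  rw [← Nat.le_div_iff_mul_le hb]
  refine csSup_le ⟨0, ∅, by simp, fun 𝒜 _ _ B hB => by simp at hB, rfl⟩ ?_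
  rintro _ ⟨H, hr, hH, rfl⟩
  exact (Nat.le_div_iff_mul_le hb).2 (hH.card_mul_choose_le ht hk hr)

theorem RandomPacking.card_map_inter_placed_lt {W : Type} [Fintype W] [DecidableEq W] {k n : ℕ}
    {𝒮 : Finset (Finset W)}
    (R : RandomPacking (kImages k 𝒮 : (W ↪ Fin n) → Finset {T : Finset (Fin n) // #T = k})
      (kImages k (powersetCard k univ \ 𝒮)))
    {ω : R.Ω} {φ ψ : W ↪ Fin n} (hφ : φ ∈ R.chosen ω) (hψ : ψ ∈ R.chosen ω) (hne : φ ≠ ψ)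
    {A : Finset W} (hA : powersetCard k A ⊆ 𝒮) : #(A.map φ ∩ placed ψ) < k := by
  by_contra! h
  obtain ⟨T, hT, hTk⟩ := exists_subset_card_eq h
  obtain ⟨S, hS, hST⟩ := subset_map_iff.1 (hT.trans inter_subset_left)
  have hSk : #S = k := by rw [← hTk, hST, card_map]
  have hTφ : (⟨T, hTk⟩ : {T : Finset (Fin n) // #T = k}) ∈ kImages k 𝒮 φ :=
    mem_kImages.2 ⟨S, hA (mem_powersetCard.2 ⟨hS, hSk⟩), hST.symm⟩
  have hTψ := mem_kImages_union_compl (𝒮 := 𝒮) (φ := ψ) (T := ⟨T, hTk⟩) |>.2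
    (hT.trans inter_subset_right)
  rcases mem_union.1 hTψ with h' | h'
  · exact disjoint_left.1 (R.pairwise ω φ hφ ψ hψ hne) hTφ h'
  · exact disjoint_left.1 (R.disjoint_junk ω φ hφ) hTφ (R.subset_junk ω ψ hψ h')

/-- Packing copies of a cluster so that the claimed `k`-sets are disjoint and cover almost all
`k`-sets yields a cancellative family. -/
theorem IsCluster.eventually_le_maxCancellative {W ι : Type} [Fintype W] [DecidableEq W]
    [Fintype ι] [Nonempty ι] {e : ι → Finset W} {t k : ℕ} (ht : 2 ≤ t) (hk : 2 ≤ k)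
    (he : IsCluster k (t * k) (2 * t) e) {𝒮 : Finset (Finset W)}
    (h𝒮 : ∀ S, S ∈ 𝒮 ↔ #S = k ∧ ∃ i, S ⊆ e i) {δ : ℝ} (hδ : 0 < δ) (hδ1 : δ ≤ 1) :
    ∃ C : ℝ, 0 ≤ C ∧ ∀ᶠ n : ℕ in Filter.atTop, (1 - δ) * n.choose k * Fintype.card ι ≤
      #𝒮 * (maxCancellative (2 * (t - 1)) n (t * k) + C * n ^ (k - 1)) := by
  obtain ⟨i₀⟩ := ‹Nonempty ι›
  have hk0 : 0 < k := by omega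
  have hkr : k < t * k := by nlinarith
  have hkw : k < Fintype.card W := hkr.trans_le ((he.card i₀).ge.trans (card_le_univ _))
  set w := Fintype.card W with hw
  have hne : 𝒮.Nonempty := by
    obtain ⟨S, hS, hSk⟩ := exists_subset_card_eq (hkr.le.trans (he.card i₀).ge)
    exact ⟨S, (h𝒮 S).2 ⟨hSk, i₀, hS⟩⟩
  obtain ⟨c, hc, hreach⟩ := reaches_of_pos (j := #(powersetCard k univ \ 𝒮)) (z := δ / 4)
    (τ := δ / 4) hne.card_pos (by positivity) (by linarith) (by positivity) (by linarith)
  obtain ⟨ε₀, hε₀, hreach⟩ := hreach 1 (δ / 4) (by positivity)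
  obtain ⟨C, hC, hsparse⟩ := exists_sparse_placements W hk0 hkw (2 * t) (c := c * 2 ^ w)
    (by positivity)
  refine ⟨C * Fintype.card ι, by positivity, ?_⟩
  filter_upwards [Filter.eventually_ge_atTop (2 * w),
    (tendsto_const_div_atTop_nhds_zero_nat
      ((2 : ℝ) ^ w * (2 * k + w) ^ w)).eventually_le_const hε₀] with n hn hε
  have hn0 : 0 < n := by omega
  have hn' : (0 : ℝ) < n := by exact_mod_cast hn0
  obtain ⟨A, hAn, hsys⟩ := exists_isClaimSystem (fun S hS => ((h𝒮 S).1 hS).1) hne hkw hn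
  obtain ⟨R, v, hv0, hvu, hR, hmom⟩ := hreach _ _ _ _ A _ hsys hε
  have hcount := hsys.card_le_sum_mul_card_chosen R le_rfl hR
  have hAn' : (n : ℝ) ^ (w - k) ≤ 2 ^ w * A := by exact_mod_cast hAn
  have hA0 : (0 : ℝ) < A := by
    by_contra! h
    have : (0 : ℝ) < n ^ (w - k) := by positivity
    have : (2 : ℝ) ^ w * A ≤ 0 := mul_nonpos_of_nonneg_of_nonpos (by positivity) h
    linarith
  obtain ⟨ω, F, hFX, hFs, hFcard⟩ := hsparse n hn0 R.Ω R.μ R.chosen R.nonneg R.sum_eq_one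
    (hmom.mono (by positivity) (by
      rw [div_le_div_iff₀ hA0 (by positivity), mul_assoc]
      exact mul_le_mul_of_nonneg_left hAn' hc))
  have hF : ∀ φ ∈ F, ∀ ψ ∈ F, φ ≠ ψ → ∀ i, #((e i).map φ ∩ placed ψ) < k := by
    intro φ hφ ψ hψ hφψ i
    refine R.card_map_inter_placed_lt (hFX hφ) (hFX hψ) hφψ fun S hS => ?_
    obtain ⟨h1, h2⟩ := mem_powersetCard.1 hS
    exact (h𝒮 S).2 ⟨h2, i, h1⟩
  have hH := he.isCancellative_image_copyEdge (by omega) hk0 hFs hF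
  have hle := hH.card_le_maxCancellative (r := t * k) (by
    intro B hB
    obtain ⟨x, -, rfl⟩ := mem_image.1 hB
    exact he.card_copyEdge x)
  rw [card_image_of_injOn, card_product, card_univ] at hle
  swap
  · intro x hx y hy hxy
    exact he.copyEdge_injOn hkr.le hF (mem_product.1 (mem_coe.1 hx)).1
      (mem_product.1 (mem_coe.1 hy)).1 hxy
  rw [Fintype.card_finset_len, Fintype.card_fin] at hcount
  have hle' : (#F : ℝ) * Fintype.card ι ≤ maxCancellative (2 * (t - 1)) n (t * k) := by
    exact_mod_cast hle
  have h1 : (1 - δ) * n.choose k ≤ (#𝒮 : ℝ) * (#F + C * n ^ (k - 1)) :=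
    calc (1 - δ) * n.choose k ≤ (1 - v - δ / 4 - 2 * (δ / 4)) * n.choose k := by
          refine mul_le_mul_of_nonneg_right ?_ (Nat.cast_nonneg _)
          linarith
      _ ≤ _ := hcount
      _ ≤ _ := by gcongr; linarith
  calc (1 - δ) * n.choose k * Fintype.card ι
      ≤ (#𝒮 : ℝ) * (#F + C * n ^ (k - 1)) * Fintype.card ι := by gcongr
    _ = #𝒮 * (#F * Fintype.card ι + C * Fintype.card ι * n ^ (k - 1)) := by ring
    _ ≤ _ := by gcongr

/-- The number of `k`-subsets of an `n`-set is asymptotically `n ^ k / k!`. -/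
theorem tendsto_choose_div_pow (k : ℕ) :
    Filter.Tendsto (fun n : ℕ => (n.choose k : ℝ) / (n : ℝ) ^ k) Filter.atTop
      (nhds (1 / (Nat.factorial k : ℝ))) := by
  refine ((isEquivalent_choose k).div (Asymptotics.IsEquivalent.refl
    (u := fun n : ℕ => (n : ℝ) ^ k))).symm.tendsto_nhds ?_
  refine tendsto_const_nhds.congr' ?_
  filter_upwards [Filter.eventually_gt_atTop 0] with n hn
  have : (n : ℝ) ≠ 0 := by positivity
  simp only [Pi.div_apply]
  field_simp

theorem eventually_lt_maxCancellative_div {t k : ℕ} (ht : 2 ≤ t) (hk : 2 ≤ k) {a : ℝ}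
    (ha : a < 1 / (Nat.factorial k : ℝ) * (1 / ((t * k - 1).choose (k - 1) : ℝ))) :
    ∀ᶠ n : ℕ in Filter.atTop,
      a < (maxCancellative (2 * (t - 1)) n (t * k) : ℝ) / (n : ℝ) ^ k := by
  set b : ℝ := ((t * k - 1).choose (k - 1) : ℝ) with hb
  have hb0 : 0 < b := Nat.cast_pos.2 (Nat.choose_pos
    (Nat.sub_le_sub_right (Nat.le_mul_of_pos_left k (by omega)) 1))
  obtain ⟨ε, hε, hε1⟩ : ∃ ε : ℝ, a < (1 - ε) * (1 / (Nat.factorial k : ℝ)) / (b + ε) ∧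
      ε ∈ Set.Ioo (0 : ℝ) 1 := by
    have hcont : ContinuousAt
        (fun ε : ℝ => (1 - ε) * (1 / (Nat.factorial k : ℝ)) / (b + ε)) 0 :=
      ContinuousAt.div (by fun_prop) (by fun_prop) (by simpa using hb0.ne')
    have h1 : ∀ᶠ ε in nhds (0 : ℝ), a < (1 - ε) * (1 / (Nat.factorial k : ℝ)) / (b + ε) :=
      hcont.eventually_const_lt (by simpa [div_eq_mul_inv] using ha)
    exact ((h1.filter_mono nhdsWithin_le_nhds).and
      (Ioo_mem_nhdsGT zero_lt_one)).exists
  have hkr : k + 2 ≤ t * k := by nlinarith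
  obtain ⟨W, ι, _, _, _, e, hι, he, hcard⟩ := exists_cluster (by omega) hkr (2 * t) hε1.1
  obtain ⟨𝒮, h𝒮, hcard⟩ : ∃ 𝒮 : Finset (Finset W), (∀ S, S ∈ 𝒮 ↔ #S = k ∧ ∃ i, S ⊆ e i) ∧
      (#𝒮 : ℝ) ≤ (b + ε) * Fintype.card ι := by
    refine ⟨_, fun S => ?_, hcard⟩
    simp
  obtain ⟨C, hC0, hC⟩ := he.eventually_le_maxCancellative ht hk h𝒮 hε1.1 hε1.2.le
  have hlim : Filter.Tendsto
      (fun n : ℕ => (1 - ε) * ((n.choose k : ℝ) / (n : ℝ) ^ k) / (b + ε) - C / n)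
      Filter.atTop (nhds ((1 - ε) * (1 / (Nat.factorial k : ℝ)) / (b + ε) - 0)) :=
    (((tendsto_choose_div_pow k).const_mul _).div_const _).sub
      (tendsto_const_div_atTop_nhds_zero_nat C)
  rw [sub_zero] at hlim
  filter_upwards [hC, hlim.eventually_const_lt hε, Filter.eventually_gt_atTop 0] with n h1 h2 hn
  refine h2.trans_le ?_
  have hn' : (0 : ℝ) < n := by exact_mod_cast hn
  have hι' : (0 : ℝ) < Fintype.card ι := by exact_mod_cast Fintype.card_pos
  have hbε : 0 < b + ε := add_pos hb0 hε1.1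
  have hpow : (n : ℝ) ^ k = n ^ (k - 1) * n := by rw [← pow_succ, Nat.sub_add_cancel (by omega)]
  set M : ℝ := (maxCancellative (2 * (t - 1)) n (t * k) : ℝ) with hM
  have h3 : (1 - ε) * n.choose k ≤ (b + ε) * (M + C * n ^ (k - 1)) := by
    refine le_of_mul_le_mul_right (h1.trans ?_) hι'
    rw [mul_right_comm]
    exact mul_le_mul_of_nonneg_right hcard (by positivity)
  rw [sub_le_iff_le_add, div_le_iff₀ hbε, ← mul_div_assoc, div_le_iff₀ (by positivity)]
  refine h3.trans (le_of_eq ?_)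
  rw [hpow]
  field_simp

/-- For all `t ≥ 2` and `k ≥ 2`, `C_{2(t-1)}(n, tk) / n^k → (1/k!) · 1/C(tk-1, k-1)`. -/
theorem cancellative_degenerate_turan_density (t k : ℕ) (ht : 2 ≤ t) (hk : 2 ≤ k) :
    Filter.Tendsto
      (fun n : ℕ => (maxCancellative (2 * (t - 1)) n (t * k) : ℝ) / (n : ℝ) ^ k)
      Filter.atTop
      (nhds (1 / (Nat.factorial k : ℝ) * (1 / ((t * k - 1).choose (k - 1) : ℝ)))) := by
  have hb0 : (0 : ℝ) < ((t * k - 1).choose (k - 1) : ℝ) := Nat.cast_pos.2 (Nat.choose_pos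
    (Nat.sub_le_sub_right (Nat.le_mul_of_pos_left k (by omega)) 1))
  refine tendsto_order.2 ⟨fun a ha => eventually_lt_maxCancellative_div ht hk ha, fun a ha => ?_⟩
  filter_upwards [((tendsto_choose_div_pow k).mul_const _).eventually_lt_const ha] with n hn
  refine lt_of_le_of_lt ?_ hn
  rw [div_mul_div_comm, mul_one, div_mul_eq_div_div_swap]
  gcongr
  rw [le_div_iff₀ hb0]
  exact_mod_cast maxCancellative_mul_choose_le (by omega) (by omega) n
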